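/- arXiv:1804.04884 — 2 statements merged into one kernel-verified Lean document; each statement's English description precedes it below -/
import Mathlib

section
/- Let φ(z) = z² and T = C_φ the composition operator on the space 𝒜((0,1)) of real analytic functions on (0,1). Then T is sequentially hypercyclic: there exists f ∈ 𝒜((0,1)) such that for every g ∈ 𝒜((0,1)) there is an increasing sequence (n_k) with f(x^{2^{n_k}}) → g(x) in the topology of 𝒜((0,1)). -/
open Filter Topology

/-- A real function that is analytic at a point extends holomorphically to a complex disc. -/
theorem AnalyticAt.exists_complex_extension {h : ℝ → ℝ} {x₀ : ℝ} (hh : AnalyticAt ℝ h x₀) :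
    ∃ r > 0, ∃ G : ℂ → ℂ, DifferentiableOn ℂ G (Metric.ball (x₀ : ℂ) r) ∧
      ∀ t : ℝ, |t - x₀| < r → G t = h t := by
  obtain ⟨p, R, hp⟩ := hh
  obtain ⟨r, hr0, hrR⟩ := ENNReal.lt_iff_exists_nnreal_btwn.mp hp.r_pos
  have hrad : (r : ENNReal) < p.radius := hrR.trans_le hp.r_le
  refine ⟨r, by exact_mod_cast hr0, fun z => ∑' n, (p.coeff n : ℂ) * (z - x₀) ^ n, ?_, ?_⟩
  · refine Complex.differentiableOn_tsum_of_summable_norm (p.summable_norm_mul_pow hrad)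
      (fun n => by fun_prop) Metric.isOpen_ball fun n z hz => ?_
    rw [norm_mul, norm_pow, Complex.norm_real, p.norm_apply_eq_norm_coef]
    rw [mem_ball_iff_norm] at hz
    gcongr
  · intro t ht
    have hs := hp.hasSum_sub (y := t) (by
      rw [Metric.mem_eball, edist_dist, Real.dist_eq]
      refine lt_trans ?_ hrR
      rw [ENNReal.ofReal_lt_iff_lt_toReal (abs_nonneg _) ENNReal.coe_ne_top]
      simpa using ht)
    simp only [p.apply_eq_pow_smul_coeff, smul_eq_mul] at hs
    rw [← Complex.hasSum_ofReal] at hs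
    rw [← hs.tsum_eq]
    push_cast
    simp only [mul_comm]

/-- Inductive choice of a sequence whose pairwise constraints can all be met by late terms. -/
theorem exists_strictMono_of_forall_eventually {P : ℕ → ℕ → ℕ → ℕ → Prop}
    (hP : ∀ i a j, ∀ᶠ b in atTop, P i a j b) :
    ∃ N : ℕ → ℕ, StrictMono N ∧ ∀ i j, i < j → P i (N i) j (N j) := by
  simp only [eventually_atTop] at hP
  choose c hc using hP
  let N : ℕ → ℕ := fun n => Nat.rec 0 (fun j b => b + 1 +
    ∑ i ∈ Finset.range (j + 1), ∑ a ∈ Finset.range (b + 1), c i a (j + 1)) n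
  have hN : ∀ j, N (j + 1) = N j + 1 +
    ∑ i ∈ Finset.range (j + 1), ∑ a ∈ Finset.range (N j + 1), c i a (j + 1) := fun j => rfl
  have hmono : StrictMono N := strictMono_nat_of_lt_succ fun j => by rw [hN]; omega
  refine ⟨N, hmono, fun i j hij => ?_⟩
  obtain ⟨j, rfl⟩ : ∃ m, j = m + 1 := ⟨j - 1, by omega⟩
  apply hc
  have h1 : N i ≤ N j := hmono.monotone (by omega)
  calc c i (N i) (j + 1) ≤ ∑ a ∈ Finset.range (N j + 1), c i a (j + 1) :=
        Finset.single_le_sum (f := fun a => c i a (j + 1)) (fun _ _ => Nat.zero_le _)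
          (Finset.mem_range.mpr (by omega))
    _ ≤ ∑ i ∈ Finset.range (j + 1), ∑ a ∈ Finset.range (N j + 1), c i a (j + 1) :=
        Finset.single_le_sum (f := fun i => ∑ a ∈ Finset.range (N j + 1), c i a (j + 1))
          (fun _ _ => Nat.zero_le _) (Finset.mem_range.mpr (by omega))
    _ ≤ N (j + 1) := by rw [hN]; omega

/-- Entire functions, real on the real line, that tend to zero at both ends of every horizontal
strip. -/
structure StripDecay (u : ℂ → ℂ) : Prop where
  differentiable : Differentiable ℂ u
  im_eq_zero : ∀ x : ℝ, (u x).im = 0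
  decay : ∀ C ε : ℝ, 0 < ε → ∃ R : ℝ, ∀ z : ℂ, |z.im| ≤ C → R ≤ |z.re| → ‖u z‖ ≤ ε

theorem StripDecay.eventually_add_natCast {u : ℂ → ℂ} (hu : StripDecay u) (w : ℂ) (C : ℝ) {ε : ℝ}
    (hε : 0 < ε) : ∀ᶠ b : ℕ in atTop, ∀ z : ℂ, ‖z‖ ≤ C → ‖u (z + b - w)‖ ≤ ε := by
  obtain ⟨R, hR⟩ := hu.decay (C + |w.im|) ε hε
  filter_upwards [eventually_ge_atTop ⌈R + C + |w.re|⌉₊] with b hb z hz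
  have hb' : R + C + |w.re| ≤ b := Nat.ceil_le.mp hb
  have h1 := (Complex.abs_re_le_norm z).trans hz
  have h2 := (Complex.abs_im_le_norm z).trans hz
  apply hR
  · simp only [Complex.sub_im, Complex.add_im, Complex.natCast_im, add_zero]
    exact (abs_sub _ _).trans (by gcongr)
  · simp only [Complex.sub_re, Complex.add_re, Complex.natCast_re]
    refine le_trans ?_ (le_abs_self _)
    linarith [neg_abs_le z.re, le_abs_self w.re]

theorem StripDecay.eventually_sub_natCast {u : ℂ → ℂ} (hu : StripDecay u) (C : ℝ) {ε : ℝ}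
    (hε : 0 < ε) : ∀ᶠ b : ℕ in atTop, ∀ z : ℂ, ‖z‖ ≤ C → ‖u (z - b)‖ ≤ ε := by
  obtain ⟨R, hR⟩ := hu.decay C ε hε
  filter_upwards [eventually_ge_atTop ⌈R + C⌉₊] with b hb z hz
  have hb' : R + C ≤ b := Nat.ceil_le.mp hb
  have h1 := (Complex.abs_re_le_norm z).trans hz
  have h2 := (Complex.abs_im_le_norm z).trans hz
  apply hR
  · simpa using h2
  · simp only [Complex.sub_re, Complex.natCast_re]
    refine le_trans ?_ (neg_le_abs _)
    linarith [le_abs_self z.re]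

/-- Birkhoff's construction: some entire function has translates close to each member of a given
sequence, on discs of growing radius. -/
theorem exists_entire_translates_near {q : ℕ → ℂ → ℂ} (hq : ∀ i, StripDecay (q i)) :
    ∃ F : ℂ → ℂ, Differentiable ℂ F ∧ (∀ x : ℝ, (F x).im = 0) ∧
      ∃ N : ℕ → ℕ, StrictMono N ∧
        ∀ j : ℕ, ∀ z : ℂ, ‖z‖ ≤ j → ‖F (z + N j) - q j z‖ ≤ 2 * (1 / 2) ^ j := by
  obtain ⟨N, hN, hP⟩ := exists_strictMono_of_forall_eventually
    (P := fun i a j b =>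
      (∀ z : ℂ, ‖z‖ ≤ (j : ℝ) → ‖q i (z + b - a)‖ ≤ (1 / 2) ^ i * (1 / 2) ^ j) ∧
      ∀ z : ℂ, ‖z‖ ≤ (a : ℝ) + i → ‖q j (z - b)‖ ≤ (1 / 2) ^ i * (1 / 2) ^ j)
    fun i a j => ((hq i).eventually_add_natCast a j (by positivity)).and
      ((hq j).eventually_sub_natCast (a + i) (by positivity))
  have hgeo : Summable fun i : ℕ => ((1 : ℝ) / 2) ^ i := summable_geometric_two
  have hbound : ∀ m : ℕ, ∃ u : ℕ → ℝ, Summable u ∧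
      ∀ i, ∀ z ∈ Metric.ball (0 : ℂ) m, ‖q i (z - N i)‖ ≤ u i := by
    intro m
    have hC : ∀ i, ∃ C, ∀ z ∈ Metric.closedBall (0 : ℂ) m, ‖q i (z - N i)‖ ≤ C := fun i =>
      (isCompact_closedBall _ _).exists_bound_of_continuousOn
        ((hq i).differentiable.continuous.comp (by fun_prop)).continuousOn
    choose C hC using hC
    refine ⟨fun i => if i ≤ m then C i else (1 / 2) ^ i, ?_, fun i z hz => ?_⟩
    · refine (summable_nat_add_iff (m + 1)).mp ?_
      refine ((summable_nat_add_iff (m + 1)).mpr hgeo).congr fun i => ?_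
      rw [if_neg (by omega)]
    · dsimp only
      split_ifs with hi
      · exact hC i z (Metric.ball_subset_closedBall hz)
      · refine ((hP m i (by omega)).2 z ?_).trans ?_
        · rw [mem_ball_zero_iff] at hz
          linarith [(N m).cast_nonneg (α := ℝ)]
        · exact mul_le_of_le_one_left (by positivity) (pow_le_one₀ (by norm_num) (by norm_num))
  have hsum : ∀ z : ℂ, Summable fun i => q i (z - N i) := by
    intro z
    obtain ⟨m, hm⟩ := exists_nat_gt ‖z‖
    obtain ⟨u, hu, hqu⟩ := hbound m
    exact .of_norm_bounded hu fun i => hqu i z (mem_ball_zero_iff.mpr hm)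
  refine ⟨fun z => ∑' i, q i (z - N i), fun z => ?_, fun x => ?_, N, hN, fun j z hz => ?_⟩
  · obtain ⟨m, hm⟩ := exists_nat_gt ‖z‖
    obtain ⟨u, hu, hqu⟩ := hbound m
    exact (Complex.differentiableOn_tsum_of_summable_norm hu
      (fun i => ((hq i).differentiable.comp (by fun_prop)).differentiableOn) Metric.isOpen_ball
      hqu).differentiableAt (Metric.isOpen_ball.mem_nhds (mem_ball_zero_iff.mpr hm))
  · rw [Complex.im_tsum (hsum x)]
    refine (tsum_congr fun i => ?_).trans tsum_zero
    have := (hq i).im_eq_zero (x - N i)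
    push_cast at this
    exact this
  · dsimp only
    rw [(hsum _).tsum_eq_add_tsum_ite j]
    rw [add_sub_cancel_right, add_sub_cancel_left]
    refine tsum_of_norm_bounded (hasSum_geometric_two.mul_right _) fun i => ?_
    split_ifs with hij
    · rw [norm_zero]; positivity
    · rcases lt_or_gt_of_ne hij with hij | hij
      · exact (hP i j hij).1 z hz
      · refine ((hP j i hij).2 (z + N j) ?_).trans_eq (mul_comm _ _)
        refine (norm_add_le _ _).trans ?_
        rw [Complex.norm_natCast]
        linarith

/-- A single entire function has integer translates approximating every function in `StripDecay`. -/
theorem exists_entire_universal :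
    ∃ F : ℂ → ℂ, Differentiable ℂ F ∧ (∀ x : ℝ, (F x).im = 0) ∧
      ∀ u : ℂ → ℂ, StripDecay u → ∀ R ε : ℝ, 0 < ε →
        ∃ᶠ n : ℕ in atTop, ∀ z : ℂ, ‖z‖ ≤ R → ‖F (z + n) - u z‖ ≤ ε := by
  let Q : Set C(ℂ, ℂ) := {u | StripDecay u}
  have h0 : StripDecay fun _ => (0 : ℂ) :=
    ⟨differentiable_const 0, by simp, fun C ε hε => ⟨0, by simp [hε.le]⟩⟩
  have : Nonempty Q := ⟨⟨0, h0⟩⟩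
  let q : ℕ → Q := TopologicalSpace.denseSeq Q
  obtain ⟨F, hF, hFim, N, hN, hFN⟩ := exists_entire_translates_near
    (q := fun j => (q j.unpair.1 : C(ℂ, ℂ))) fun j => (q j.unpair.1).2
  refine ⟨F, hF, hFim, fun u hu R ε hε => ?_⟩
  let v : Q := ⟨⟨u, hu.differentiable.continuous⟩, hu⟩
  have hev : ∀ᶠ w : Q in 𝓝 v, ∀ z ∈ Metric.closedBall (0 : ℂ) R,
      ‖(w : C(ℂ, ℂ)) z - u z‖ < ε / 2 := by
    have ht : Tendsto (fun w : Q => (w : C(ℂ, ℂ))) (𝓝 v) (𝓝 (v : C(ℂ, ℂ))) :=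
      continuous_subtype_val.tendsto v
    have := Metric.tendstoUniformlyOn_iff.mp
      (ContinuousMap.tendsto_iff_forall_isCompact_tendstoUniformlyOn.mp ht _
        (isCompact_closedBall (0 : ℂ) R)) (ε / 2) (half_pos hε)
    filter_upwards [this] with w hw z hz
    simpa [dist_eq_norm, norm_sub_rev, v] using hw z hz
  obtain ⟨i, hi⟩ : ∃ i, ∀ z ∈ Metric.closedBall (0 : ℂ) R, ‖(q i : C(ℂ, ℂ)) z - u z‖ < ε / 2 := by
    obtain ⟨w, ⟨i, rfl⟩, hw⟩ := (TopologicalSpace.denseRange_denseSeq Q).inter_nhds_nonempty hev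
    exact ⟨i, hw⟩
  have htend : Tendsto (fun j : ℕ => 2 * ((1 : ℝ) / 2) ^ j) atTop (𝓝 0) := by
    simpa using (tendsto_pow_atTop_nhds_zero_of_lt_one (by norm_num : (0 : ℝ) ≤ 1 / 2)
      (by norm_num)).const_mul 2
  obtain ⟨j₀, hj₀⟩ := eventually_atTop.mp
    ((htend.eventually (gt_mem_nhds (half_pos hε))).and (eventually_ge_atTop ⌈R⌉₊))
  rw [frequently_atTop]
  intro m
  let j := Nat.pair i (max j₀ m)
  have hj : max j₀ m ≤ j := Nat.right_le_pair _ _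
  refine ⟨N j, (le_max_right j₀ m).trans (hj.trans hN.le_apply), fun z hz => ?_⟩
  obtain ⟨h1, h2⟩ := hj₀ j ((le_max_left _ _).trans hj)
  have h3 := hFN j z (hz.trans (Nat.ceil_le.mp h2))
  have h4 := hi z (mem_closedBall_zero_iff.mpr hz)
  simp only [j, Nat.unpair_pair] at h3 h1
  have h5 := norm_sub_le_norm_sub_add_norm_sub (F (z + N j)) ((q i : C(ℂ, ℂ)) z) (u z)
  simp only [j] at h5 ⊢
  linarith

/-- The Gaussian kernel of total mass one on the real line, with width of order `1 / a`. -/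
noncomputable def gaussKernel (a : ℝ) (w : ℂ) : ℂ :=
  ((a / √Real.pi : ℝ) : ℂ) * Complex.exp (-(a : ℂ) ^ 2 * w ^ 2)

theorem differentiable_gaussKernel (a : ℝ) : Differentiable ℂ (gaussKernel a) := by
  unfold gaussKernel
  fun_prop

theorem gaussKernel_ofReal (a s : ℝ) :
    gaussKernel a s = ((a / √Real.pi * Real.exp (-(a ^ 2) * s ^ 2) : ℝ) : ℂ) := by
  simp [gaussKernel]

theorem norm_gaussKernel {a : ℝ} (ha : 0 ≤ a) (w : ℂ) :
    ‖gaussKernel a w‖ = a / √Real.pi * Real.exp (-(a ^ 2) * (w.re ^ 2 - w.im ^ 2)) := by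
  rw [gaussKernel, norm_mul, Complex.norm_real, Real.norm_of_nonneg (by positivity),
    Complex.norm_exp, ← Complex.ofReal_pow, ← Complex.ofReal_neg, Complex.re_ofReal_mul]
  simp [pow_two]

theorem norm_gaussKernel_le {a c : ℝ} (ha : 0 ≤ a) {w : ℂ} (hw : c ≤ w.re ^ 2 - w.im ^ 2) :
    ‖gaussKernel a w‖ ≤ a * Real.exp (-(a ^ 2) * c) := by
  rw [norm_gaussKernel ha]
  have hpi : 1 ≤ √Real.pi := Real.one_le_sqrt.mpr (by linarith [Real.pi_gt_three])
  refine mul_le_mul (div_le_self ha hpi) (Real.exp_le_exp.mpr ?_) (Real.exp_pos _).le ha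
  nlinarith [sq_nonneg a]

theorem integrable_gaussKernel {a : ℝ} (ha : 0 < a) (x : ℝ) :
    MeasureTheory.Integrable fun t : ℝ => gaussKernel a (x - t) := by
  have h := (((integrable_exp_neg_mul_sq (b := a ^ 2) (by positivity)).const_mul
    (a / √Real.pi)).comp_sub_left x).ofReal (𝕜 := ℂ)
  refine h.congr (Eventually.of_forall fun t => ?_)
  simp only [← Complex.ofReal_sub, gaussKernel_ofReal]
  rfl

theorem integral_gaussKernel {a : ℝ} (ha : 0 < a) (x : ℝ) :
    ∫ t : ℝ, gaussKernel a (x - t) = 1 := by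
  simp only [← Complex.ofReal_sub]
  rw [MeasureTheory.integral_sub_left_eq_self (fun s : ℝ => gaussKernel a s)]
  simp only [gaussKernel_ofReal]
  rw [integral_complex_ofReal, MeasureTheory.integral_const_mul, integral_gaussian,
    Real.sqrt_div' _ (by positivity), Real.sqrt_sq ha.le]
  have : √Real.pi ≠ 0 := by positivity
  norm_cast
  field_simp

/-- The Gaussian kernel has first absolute moment of order `1 / a`. -/
theorem exists_gaussKernel_moment : ∃ c : ℝ, ∀ a : ℝ, 0 < a → ∀ x : ℝ,
    MeasureTheory.Integrable (fun t : ℝ => |t - x| * ‖gaussKernel a (x - t)‖) ∧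
      ∫ t : ℝ, |t - x| * ‖gaussKernel a (x - t)‖ = c / a := by
  let m : ℝ → ℝ := fun s => |s| * (1 / √Real.pi * Real.exp (-1 * s ^ 2))
  have hm : MeasureTheory.Integrable m := by
    refine ((integrable_mul_exp_neg_mul_sq one_pos).norm.const_mul (1 / √Real.pi)).congr
      (Eventually.of_forall fun s => ?_)
    simp only [norm_mul, Real.norm_eq_abs, Real.abs_exp, m]
    ring
  have key : ∀ a : ℝ, 0 < a → ∀ x t : ℝ,
      |t - x| * ‖gaussKernel a (x - t)‖ = m (a * (x - t)) := by
    intro a ha x t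
    rw [← Complex.ofReal_sub, norm_gaussKernel ha.le]
    simp only [m, abs_mul, abs_of_pos ha, Complex.ofReal_re, Complex.ofReal_im, abs_sub_comm t x]
    rw [show -(a ^ 2) * ((x - t) ^ 2 - 0 ^ 2) = -1 * (a * (x - t)) ^ 2 by ring]
    ring
  refine ⟨∫ s, m s, fun a ha x => ?_⟩
  simp only [key a ha x]
  constructor
  · exact (hm.comp_mul_left' ha.ne').comp_sub_left x
  · rw [MeasureTheory.integral_sub_left_eq_self (fun s : ℝ => m (a * s)),
      MeasureTheory.Measure.integral_comp_mul_left, abs_of_pos (inv_pos.mpr ha), smul_eq_mul]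
    ring

theorem norm_integral_mul_gaussKernel_sub_le {c : ℝ} (hc : ∀ a : ℝ, 0 < a → ∀ x : ℝ,
      MeasureTheory.Integrable (fun t : ℝ => |t - x| * ‖gaussKernel a (x - t)‖) ∧
        ∫ t : ℝ, |t - x| * ‖gaussKernel a (x - t)‖ = c / a)
    {a : ℝ} (ha : 0 < a) {g : ℝ → ℂ} (hg : MeasureTheory.AEStronglyMeasurable g) {C x : ℝ} {v : ℂ}
    (hgv : ∀ t, ‖g t - v‖ ≤ C * |t - x|) :
    ‖(∫ t : ℝ, g t * gaussKernel a (x - t)) - v‖ ≤ C * (c / a) := by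
  obtain ⟨hi, hI⟩ := hc a ha x
  have hK := integrable_gaussKernel ha x
  have hle : ∀ t : ℝ, ‖(g t - v) * gaussKernel a (x - t)‖ ≤
      C * (|t - x| * ‖gaussKernel a (x - t)‖) := fun t => by
    rw [norm_mul, ← mul_assoc]
    exact mul_le_mul_of_nonneg_right (hgv t) (norm_nonneg _)
  have hd : MeasureTheory.Integrable fun t : ℝ => (g t - v) * gaussKernel a (x - t) :=
    (hi.const_mul C).mono' ((hg.sub MeasureTheory.aestronglyMeasurable_const).mul
      hK.aestronglyMeasurable) (Eventually.of_forall hle)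
  have hsplit : ∫ t : ℝ, g t * gaussKernel a (x - t) =
      (∫ t : ℝ, (g t - v) * gaussKernel a (x - t)) + v := by
    have hv : ∫ t : ℝ, v * gaussKernel a (x - t) = v := by
      rw [MeasureTheory.integral_const_mul, integral_gaussKernel ha x, mul_one]
    nth_rewrite 2 [← hv]
    rw [← MeasureTheory.integral_add hd (hK.const_mul v)]
    congr 1 with t
    ring
  rw [hsplit, add_sub_cancel_right, ← hI, ← MeasureTheory.integral_const_mul]
  exact MeasureTheory.norm_integral_le_of_norm_le (hi.const_mul C) (Eventually.of_forall hle)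

/-- Gaussian mollification of the restriction of `h` to `[-R, R]`. -/
noncomputable def mollify (h : ℝ → ℝ) (a R : ℝ) (z : ℂ) : ℂ :=
  ∫ t in (-R)..R, (h t : ℂ) * gaussKernel a (z - t)

theorem differentiable_mollify {h : ℝ → ℝ} (hh : Continuous h) (a R : ℝ) :
    Differentiable ℂ (mollify h a R) := by
  intro z₀
  have hK := differentiable_gaussKernel a
  have hK' : Continuous (deriv (gaussKernel a)) := hK.contDiff.continuous_deriv le_top
  have hc : Continuous fun t => (h t : ℂ) := Complex.continuous_ofReal.comp hh
  have hF : ∀ z : ℂ, Continuous fun t : ℝ => (h t : ℂ) * gaussKernel a (z - t) := fun z =>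
    hc.mul (hK.continuous.comp (by fun_prop))
  have hF' : Continuous fun p : ℂ × ℝ => (h p.2 : ℂ) * deriv (gaussKernel a) (p.1 - p.2) :=
    (hc.comp continuous_snd).mul (hK'.comp (by fun_prop))
  obtain ⟨C, hC⟩ := ((isCompact_closedBall z₀ 1).prod
    (isCompact_uIcc (a := -R) (b := R))).exists_bound_of_continuousOn hF'.continuousOn
  have := intervalIntegral.hasDerivAt_integral_of_dominated_loc_of_deriv_le
    (F := fun z t => (h t : ℂ) * gaussKernel a (z - t))
    (F' := fun z t => (h t : ℂ) * deriv (gaussKernel a) (z - t)) (bound := fun _ => C)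
    (a := -R) (b := R) (μ := MeasureTheory.volume)
    (Metric.ball_mem_nhds z₀ one_pos) (Eventually.of_forall fun z => (hF z).aestronglyMeasurable)
    ((hF z₀).intervalIntegrable _ _)
    (hF'.comp (by fun_prop : Continuous fun t : ℝ => (z₀, t))).aestronglyMeasurable
    (Eventually.of_forall fun t ht z hz =>
      hC (z, t) ⟨Metric.ball_subset_closedBall hz, Set.uIoc_subset_uIcc ht⟩)
    intervalIntegrable_const
    (Eventually.of_forall fun t _ z _ => by
      have h1 := ((hK (z - t)).hasDerivAt.comp_sub_const z (t : ℂ)).const_mul (h t : ℂ)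
      exact h1)
  exact this.2.differentiableAt

theorem stripDecay_mollify {h : ℝ → ℝ} (hh : Continuous h) {a : ℝ} (ha : 0 < a) {R : ℝ}
    (hR : 0 ≤ R) : StripDecay (mollify h a R) := by
  refine ⟨differentiable_mollify hh a R, fun x => ?_, fun C ε hε => ?_⟩
  · simp only [mollify, ← Complex.ofReal_sub, gaussKernel_ofReal, ← Complex.ofReal_mul,
      intervalIntegral.integral_ofReal, Complex.ofReal_im]
  · obtain ⟨M, hM⟩ := (isCompact_uIcc (a := -R) (b := R)).exists_bound_of_continuousOn
      hh.continuousOn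
    have ht : Tendsto (fun s : ℝ => M * (a * Real.exp (-(a ^ 2) * (s ^ 2 - C ^ 2))) * |R - -R|)
        atTop (𝓝 (M * (a * 0) * |R - -R|)) := by
      refine ((Real.tendsto_exp_atBot.comp ?_).const_mul a |>.const_mul M).mul_const _
      refine Tendsto.const_mul_atTop_of_neg (neg_lt_zero.mpr (by positivity)) ?_
      exact tendsto_atTop_add_const_right _ _ (tendsto_pow_atTop two_ne_zero)
    rw [mul_zero, mul_zero, zero_mul] at ht
    obtain ⟨S, hS, hS0⟩ := ((ht.eventually (ge_mem_nhds hε)).and (eventually_ge_atTop 0)).exists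
    refine ⟨S + R, fun z hz1 hz2 => ?_⟩
    refine (intervalIntegral.norm_integral_le_of_norm_le_const fun t ht => ?_).trans hS
    have ht' := Set.uIoc_subset_uIcc ht
    rw [norm_mul, Complex.norm_real]
    refine mul_le_mul (hM t ht') (norm_gaussKernel_le ha.le ?_) (norm_nonneg _)
      ((norm_nonneg _).trans (hM t ht'))
    rw [Set.uIcc_of_le (by linarith)] at ht'
    have h1 : |t| ≤ R := abs_le.mpr ht'
    have h2 : S ≤ |z.re - t| := by linarith [abs_sub_abs_le_abs_sub z.re t]
    have h3 : S ^ 2 ≤ (z.re - t) ^ 2 := by rw [← sq_abs (z.re - t)]; gcongr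
    have h4 : z.im ^ 2 ≤ C ^ 2 := by rw [← sq_abs z.im]; gcongr
    simp only [Complex.sub_re, Complex.sub_im, Complex.ofReal_re, Complex.ofReal_im, sub_zero]
    linarith

theorem norm_mollify_sub_le {c : ℝ} (hc : ∀ a : ℝ, 0 < a → ∀ x : ℝ,
      MeasureTheory.Integrable (fun t : ℝ => |t - x| * ‖gaussKernel a (x - t)‖) ∧
        ∫ t : ℝ, |t - x| * ‖gaussKernel a (x - t)‖ = c / a)
    {h : ℝ → ℝ} (hh : Continuous h) {a R δ x₀ M L : ℝ} (ha : 0 < a) (hδ : 0 < δ)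
    (h₁ : -R ≤ x₀ - δ) (h₂ : x₀ + δ ≤ R) (hb : ∀ t ∈ Set.Icc (-R) R, |h t| * (2 * R) ≤ a)
    {G : ℂ → ℂ} (hG : DifferentiableOn ℂ G (Metric.closedBall (x₀ : ℂ) (2 * δ)))
    (hGh : ∀ t : ℝ, |t - x₀| ≤ 2 * δ → G t = h t)
    (hM : ∀ w ∈ Metric.closedBall (x₀ : ℂ) (2 * δ), ‖G w‖ ≤ M) (hL0 : 0 ≤ L)
    (hL : ∀ w ∈ Metric.closedBall (x₀ : ℂ) (2 * δ), ∀ w' ∈ Metric.closedBall (x₀ : ℂ) (2 * δ),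
      ‖G w - G w'‖ ≤ L * ‖w - w'‖)
    {z : ℂ} (hz : z ∈ Metric.ball (x₀ : ℂ) (δ / 4)) :
    ‖mollify h a R z - G z‖ ≤
      (2 * a + 2 * M * δ) * (a * Real.exp (-(a ^ 2) * (δ ^ 2 / 2))) +
        (L + 2 * M / δ) * (c / a) := by
  have hR : 0 < R := by linarith
  set e : ℝ := a * Real.exp (-(a ^ 2) * (δ ^ 2 / 2)) with he
  have he0 : 0 ≤ e := by positivity
  rw [mem_ball_iff_norm] at hz
  have hx : |z.re - x₀| < δ / 4 := by simpa using (Complex.abs_re_le_norm _).trans_lt hz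
  have hy : |z.im| < δ / 4 := by simpa using (Complex.abs_im_le_norm _).trans_lt hz
  obtain ⟨hx1, hx2⟩ := abs_lt.mp hx
  obtain ⟨hy1, hy2⟩ := abs_lt.mp hy
  have hM0 : 0 ≤ M := (norm_nonneg _).trans (hM _ (Metric.mem_closedBall_self (by linarith)))
  have hfar : ∀ {u s : ℝ}, δ ≤ |u - x₀| → |s| ≤ δ / 4 →
      δ ^ 2 / 2 ≤ (z.re - u) ^ 2 - s ^ 2 := by
    intro u s hu hs
    have h3 : 3 * δ / 4 ≤ |z.re - u| := by
      have := abs_sub_le u z.re x₀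
      rw [abs_sub_comm u z.re] at this
      linarith
    have h4 : (3 * δ / 4) ^ 2 ≤ (z.re - u) ^ 2 := by rw [← sq_abs (z.re - u)]; gcongr
    have h5 : s ^ 2 ≤ (δ / 4) ^ 2 := by rw [← sq_abs s]; gcongr
    linarith
  have hmem : ∀ {w : ℂ}, |w.re - x₀| ≤ δ → |w.im| ≤ δ / 4 →
      w ∈ Metric.closedBall (x₀ : ℂ) (2 * δ) := by
    intro w h1 h2
    rw [mem_closedBall_iff_norm]
    refine (Complex.norm_le_abs_re_add_abs_im _).trans ?_
    simp only [Complex.sub_re, Complex.ofReal_re, Complex.sub_im, Complex.ofReal_im, sub_zero]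
    linarith
  have hI : Continuous fun t : ℝ => (h t : ℂ) * gaussKernel a (z - t) :=
    (Complex.continuous_ofReal.comp hh).mul
      ((differentiable_gaussKernel a).continuous.comp (by fun_prop))
  -- the parts of the integral away from `x₀`
  have htail : ∀ p q : ℝ, p ≤ q → -R ≤ p → q ≤ R → (∀ t ∈ Set.Icc p q, δ ≤ |t - x₀|) →
      ‖∫ t in p..q, (h t : ℂ) * gaussKernel a (z - t)‖ ≤ a * e := by
    intro p q hpq hp hq hfar'
    have : ∀ t ∈ Set.uIoc p q, ‖(h t : ℂ) * gaussKernel a (z - t)‖ ≤ a / (2 * R) * e := by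
      intro t ht
      have ht' := Set.uIoc_subset_uIcc ht
      rw [Set.uIcc_of_le hpq] at ht'
      rw [norm_mul, Complex.norm_real, Real.norm_eq_abs]
      have h1 : |h t| ≤ a / (2 * R) := by
        rw [le_div_iff₀ (by positivity)]
        exact hb t ⟨hp.trans ht'.1, ht'.2.trans hq⟩
      refine mul_le_mul h1 (norm_gaussKernel_le ha.le ?_) (norm_nonneg _) (by positivity)
      simpa using hfar (hfar' t ht') hy.le
    refine (intervalIntegral.norm_integral_le_of_norm_le_const this).trans ?_
    have h1 : |q - p| ≤ 2 * R := by rw [abs_of_nonneg (by linarith)]; linarith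
    calc a / (2 * R) * e * |q - p| ≤ a / (2 * R) * e * (2 * R) := by gcongr
      _ = a * e := by field_simp
  have hT₁ := htail (-R) (x₀ - δ) h₁ le_rfl (by linarith) fun t ht => by
    rw [abs_sub_comm]; exact le_trans (by linarith [ht.2]) (le_abs_self _)
  have hT₂ := htail (x₀ + δ) R h₂ (by linarith) le_rfl fun t ht =>
    le_trans (by linarith [ht.1]) (le_abs_self _)
  have hsplit : mollify h a R z = (∫ t in (-R)..(x₀ - δ), (h t : ℂ) * gaussKernel a (z - t)) +
      (∫ t in (x₀ - δ)..(x₀ + δ), (h t : ℂ) * gaussKernel a (z - t)) +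
      ∫ t in (x₀ + δ)..R, (h t : ℂ) * gaussKernel a (z - t) := by
    rw [mollify, intervalIntegral.integral_add_adjacent_intervals,
      intervalIntegral.integral_add_adjacent_intervals] <;> exact hI.intervalIntegrable _ _
  -- moving the remaining part to the height of `z`
  have hside : ∀ u : ℝ, |u - x₀| = δ →
      ‖∫ s in (0 : ℝ)..z.im, G (u + s * Complex.I) * gaussKernel a (z - (u + s * Complex.I))‖ ≤
        M * e * δ := by
    intro u hu
    refine (intervalIntegral.norm_integral_le_of_norm_le_const (C := M * e) fun s hs => ?_).trans ?_
    · have hs' := Set.uIoc_subset_uIcc hs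
      have h1 : |s| ≤ δ / 4 := by
        have := Set.abs_sub_left_of_mem_uIcc hs'
        simp only [sub_zero] at this
        linarith
      have h2 : |z.im - s| ≤ δ / 4 := by
        have := Set.abs_sub_right_of_mem_uIcc hs'
        simp only [sub_zero] at this
        linarith
      rw [norm_mul]
      refine mul_le_mul (hM _ (hmem (by simp [hu]) (by simpa using h1)))
        (norm_gaussKernel_le ha.le ?_) (norm_nonneg _) hM0
      simpa using hfar hu.ge h2
    · gcongr
      rw [sub_zero]
      linarith
  have hS₁ := hside (x₀ - δ) (by simp [abs_of_pos hδ])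
  have hS₂ := hside (x₀ + δ) (by simp [abs_of_pos hδ])
  have hrect := Complex.integral_boundary_rect_eq_zero_of_differentiableOn
    (fun w => G w * gaussKernel a (z - w)) ⟨x₀ - δ, 0⟩ ⟨x₀ + δ, z.im⟩ (by
      refine (hG.mono fun w hw => ?_).mul
        ((differentiable_gaussKernel a).comp (by fun_prop)).differentiableOn
      obtain ⟨h1, h2⟩ := hw
      simp only [Set.mem_preimage] at h1 h2
      refine hmem ?_ ?_
      · rw [Set.uIcc_of_le (by linarith)] at h1
        exact abs_le.mpr ⟨by linarith [h1.1], by linarith [h1.2]⟩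
      · have := Set.abs_sub_left_of_mem_uIcc h2
        simp only [sub_zero] at this
        linarith)
  simp only [Complex.ofReal_zero, zero_mul, add_zero, smul_eq_mul] at hrect
  have hbase : ∫ t in (x₀ - δ)..(x₀ + δ), (h t : ℂ) * gaussKernel a (z - t) =
      ∫ t in (x₀ - δ)..(x₀ + δ), G t * gaussKernel a (z - t) := by
    refine intervalIntegral.integral_congr fun t ht => ?_
    rw [Set.uIcc_of_le (by linarith)] at ht
    rw [hGh t (abs_le.mpr ⟨by linarith [ht.1], by linarith [ht.2]⟩)]
  -- the shifted integral is a convolution with a real Gaussian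
  let g : ℝ → ℂ := (Set.Ioc (x₀ - δ) (x₀ + δ)).indicator fun t => G (t + z.im * Complex.I)
  have hnear : ∀ t ∈ Set.Icc (x₀ - δ) (x₀ + δ),
      (t + z.im * Complex.I : ℂ) ∈ Metric.closedBall (x₀ : ℂ) (2 * δ) := fun t ht =>
    hmem (by simpa using abs_le.mpr ⟨by linarith [ht.1], by linarith [ht.2]⟩) (by simpa using hy.le)
  have hzmem : z ∈ Metric.closedBall (x₀ : ℂ) (2 * δ) := hmem (by linarith) hy.le
  have hg : MeasureTheory.AEStronglyMeasurable g := by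
    rw [aestronglyMeasurable_indicator_iff measurableSet_Ioc]
    exact ContinuousOn.aestronglyMeasurable (hG.continuousOn.comp (by fun_prop)
      fun t ht => hnear t (Set.Ioc_subset_Icc_self ht)) measurableSet_Ioc
  have hconv : ∫ t in (x₀ - δ)..(x₀ + δ),
      G (t + z.im * Complex.I) * gaussKernel a (z - (t + z.im * Complex.I)) =
      ∫ t : ℝ, g t * gaussKernel a (z.re - t) := by
    rw [intervalIntegral.integral_of_le (by linarith),
      ← MeasureTheory.integral_indicator measurableSet_Ioc]
    congr 1 with t
    by_cases ht : t ∈ Set.Ioc (x₀ - δ) (x₀ + δ)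
    · simp only [g, Set.indicator_of_mem ht]
      congr 2
      apply Complex.ext <;> simp
    · simp [g, Set.indicator_of_notMem ht]
  have hmain := norm_integral_mul_gaussKernel_sub_le hc ha hg (C := L + 2 * M / δ) (x := z.re)
    (v := G z) fun t => by
      by_cases ht : t ∈ Set.Ioc (x₀ - δ) (x₀ + δ)
      · simp only [g, Set.indicator_of_mem ht]
        have h1 := hL _ (hnear t (Set.Ioc_subset_Icc_self ht)) z hzmem
        have h2 : (t + z.im * Complex.I : ℂ) - z = ((t - z.re : ℝ) : ℂ) := by
          apply Complex.ext <;> simp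
        rw [h2, Complex.norm_real, Real.norm_eq_abs] at h1
        refine h1.trans ?_
        gcongr
        exact le_add_of_nonneg_right (by positivity)
      · simp only [g, Set.indicator_of_notMem ht, zero_sub, norm_neg]
        have h1 : δ / 2 ≤ |t - z.re| := by
          rw [Set.mem_Ioc, not_and_or, not_lt, not_le] at ht
          rcases ht with ht | ht
          · exact le_trans (by linarith) (neg_le_abs _)
          · exact le_trans (by linarith) (le_abs_self _)
        calc ‖G z‖ ≤ M := hM z hzmem
          _ = 2 * M / δ * (δ / 2) := by field_simp
          _ ≤ (L + 2 * M / δ) * |t - z.re| := by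
            gcongr
            exact le_add_of_nonneg_left hL0
  rw [hconv] at hrect
  set T₁ := ∫ t in (-R)..(x₀ - δ), (h t : ℂ) * gaussKernel a (z - t)
  set T₂ := ∫ t in (x₀ + δ)..R, (h t : ℂ) * gaussKernel a (z - t)
  set S₁ := ∫ s in (0 : ℝ)..z.im, G ((x₀ - δ : ℝ) + s * Complex.I) *
    gaussKernel a (z - ((x₀ - δ : ℝ) + s * Complex.I))
  set S₂ := ∫ s in (0 : ℝ)..z.im, G ((x₀ + δ : ℝ) + s * Complex.I) *
    gaussKernel a (z - ((x₀ + δ : ℝ) + s * Complex.I))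
  set J := ∫ t : ℝ, g t * gaussKernel a (z.re - t)
  set B := ∫ t in (x₀ - δ)..(x₀ + δ), G t * gaussKernel a (z - t)
  have hfinal : mollify h a R z - G z =
      T₁ + T₂ + (Complex.I * S₁ - Complex.I * S₂) + (J - G z) := by
    rw [hsplit, hbase]
    linear_combination hrect
  rw [hfinal]
  refine (norm_add₃_le).trans ?_
  have h1 := norm_add_le T₁ T₂
  have h2 := norm_sub_le (Complex.I * S₁) (Complex.I * S₂)
  simp only [norm_mul, Complex.norm_I, one_mul] at h2
  linarith

/-- Mollifications with suitable parameters converge to a holomorphic extension of `h` on a complex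
disc. -/
theorem exists_tendstoUniformlyOn_mollify {h : ℝ → ℝ} (hh : Continuous h) {a R : ℕ → ℝ}
    (ha : Tendsto a atTop atTop) (hR : Tendsto R atTop atTop)
    (hb : ∀ k, ∀ t ∈ Set.Icc (-R k) (R k), |h t| * (2 * R k) ≤ a k) {x₀ r : ℝ} (hr : 0 < r)
    {G : ℂ → ℂ} (hG : DifferentiableOn ℂ G (Metric.ball (x₀ : ℂ) r))
    (hGh : ∀ t : ℝ, |t - x₀| < r → G t = h t) :
    ∃ ρ > 0, TendstoUniformlyOn (fun k => mollify h (a k) (R k)) G atTop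
      (Metric.ball (x₀ : ℂ) ρ) := by
  obtain ⟨c, hc⟩ := exists_gaussKernel_moment
  let δ := r / 4
  have hδ : 0 < δ := by positivity
  have hsub : Metric.closedBall (x₀ : ℂ) (2 * δ) ⊆ Metric.ball (x₀ : ℂ) r :=
    Metric.closedBall_subset_ball (by simp only [δ]; linarith)
  obtain ⟨M, hM⟩ := (isCompact_closedBall (x₀ : ℂ) (2 * δ)).exists_bound_of_continuousOn
    (hG.continuousOn.mono hsub)
  obtain ⟨L, hL⟩ := (isCompact_closedBall (x₀ : ℂ) (2 * δ)).exists_bound_of_continuousOn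
    ((hG.deriv Metric.isOpen_ball).continuousOn.mono hsub)
  have hL0 : 0 ≤ L := (norm_nonneg _).trans (hL _ (Metric.mem_closedBall_self (by positivity)))
  have hLip : ∀ w ∈ Metric.closedBall (x₀ : ℂ) (2 * δ), ∀ w' ∈ Metric.closedBall (x₀ : ℂ) (2 * δ),
      ‖G w - G w'‖ ≤ L * ‖w - w'‖ := fun w hw w' hw' =>
    (convex_closedBall _ _).norm_image_sub_le_of_norm_deriv_le
      (fun y hy => hG.differentiableAt (Metric.isOpen_ball.mem_nhds (hsub hy))) hL hw' hw
  have hlim : Tendsto (fun s : ℝ =>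
      (2 * s + 2 * M * δ) * (s * Real.exp (-(s ^ 2) * (δ ^ 2 / 2))) +
        (L + 2 * M / δ) * (c / s)) atTop (𝓝 0) := by
    have hexp : ∀ n : ℕ, Tendsto (fun s : ℝ => s ^ n * Real.exp (-(δ ^ 2 / 2) * s ^ 2)) atTop
        (𝓝 0) := by
      intro n
      have h1 := (rpow_mul_exp_neg_mul_sq_isLittleO_exp_neg (b := δ ^ 2 / 2) (by positivity)
        n).trans_tendsto (Real.tendsto_exp_atBot.comp
          (Tendsto.const_mul_atTop_of_neg (by norm_num : -(1 / 2 : ℝ) < 0) tendsto_id))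
      simpa only [Real.rpow_natCast] using h1
    have h2 := (((hexp 2).const_mul 2).add ((hexp 1).const_mul (2 * M * δ))).add
      ((tendsto_const_nhds.div_atTop tendsto_id : Tendsto (fun s : ℝ => c / s) atTop
        (𝓝 0)).const_mul (L + 2 * M / δ))
    simp only [mul_zero, add_zero] at h2
    refine h2.congr fun s => ?_
    rw [show -(δ ^ 2 / 2) * s ^ 2 = -(s ^ 2) * (δ ^ 2 / 2) by ring]
    ring
  refine ⟨δ / 4, by positivity, ?_⟩
  rw [Metric.tendstoUniformlyOn_iff]
  intro ε hε
  filter_upwards [(hlim.comp ha).eventually (gt_mem_nhds hε), ha.eventually_gt_atTop 0,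
    hR.eventually_ge_atTop (δ - x₀), hR.eventually_ge_atTop (x₀ + δ)] with k hk hak hR1 hR2 z hz
  rw [dist_comm, dist_eq_norm]
  refine lt_of_le_of_lt ?_ hk
  exact norm_mollify_sub_le hc hh hak hδ (by linarith) hR2 (hb k) (hG.mono hsub)
    (fun t ht => hGh t (ht.trans_lt (by simp only [δ]; linarith))) hM hL0 hLip hz

/-- A real analytic function on the line is the limit, locally uniformly on a complex neighbourhood
of the line, of entire functions that decay in strips. -/
theorem exists_stripDecay_tendstoLocallyUniformlyOn {h : ℝ → ℝ} (hh : ∀ x, AnalyticAt ℝ h x) :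
    ∃ u : ℕ → ℂ → ℂ, (∀ k, StripDecay (u k)) ∧ ∃ (Ω : Set ℂ) (G : ℂ → ℂ), IsOpen Ω ∧
      (∀ x : ℝ, (x : ℂ) ∈ Ω) ∧ (∀ x : ℝ, G x = h x) ∧
        TendstoLocallyUniformlyOn u G atTop Ω := by
  have hcont : Continuous h := continuous_iff_continuousAt.mpr fun x => (hh x).continuousAt
  have hB : ∀ k : ℕ, ∃ B, ∀ t ∈ Set.Icc (-(k : ℝ)) k, ‖h t‖ ≤ B := fun k =>
    isCompact_Icc.exists_bound_of_continuousOn hcont.continuousOn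
  choose B hB using hB
  have hB0 : ∀ k, 0 ≤ B k := fun k =>
    (norm_nonneg _).trans (hB k 0 ⟨neg_nonpos.mpr k.cast_nonneg, k.cast_nonneg⟩)
  let a : ℕ → ℝ := fun k => k + 1 + B k * (2 * k)
  have hak : ∀ k : ℕ, (k : ℝ) + 1 ≤ a k := fun k =>
    le_add_of_nonneg_right (mul_nonneg (hB0 k) (by positivity))
  have ha : Tendsto a atTop atTop := tendsto_atTop_mono hak
    (tendsto_atTop_add_const_right _ _ tendsto_natCast_atTop_atTop)
  have hb : ∀ k : ℕ, ∀ t ∈ Set.Icc (-(k : ℝ)) k, |h t| * (2 * k) ≤ a k := fun k t ht =>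
    (mul_le_mul_of_nonneg_right (hB k t ht) (by positivity)).trans
      (le_add_of_nonneg_left (by positivity))
  have hloc : ∀ x : ℝ, ∃ ρ > 0, ∃ G : ℂ → ℂ, G x = h x ∧
      TendstoUniformlyOn (fun k => mollify h (a k) k) G atTop (Metric.ball (x : ℂ) ρ) := by
    intro x
    obtain ⟨r, hr, G, hG, hGh⟩ := (hh x).exists_complex_extension
    obtain ⟨ρ, hρ, hlim⟩ := exists_tendstoUniformlyOn_mollify hcont ha
      tendsto_natCast_atTop_atTop hb hr hG hGh
    exact ⟨ρ, hρ, G, hGh x (by simpa using hr), hlim⟩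
  choose ρ hρ G hGh hlim using hloc
  let Γ : ℂ → ℂ := fun z => limUnder atTop fun k => mollify h (a k) k z
  have hΓ : ∀ x : ℝ, ∀ z ∈ Metric.ball (x : ℂ) (ρ x), G x z = Γ z := fun x z hz =>
    ((hlim x).tendsto_at hz).limUnder_eq.symm
  refine ⟨fun k => mollify h (a k) k,
    fun k => stripDecay_mollify hcont (lt_of_lt_of_le (by positivity) (hak k)) k.cast_nonneg,
    ⋃ x : ℝ, Metric.ball (x : ℂ) (ρ x), Γ, isOpen_iUnion fun x => Metric.isOpen_ball,
    fun x => Set.mem_iUnion.mpr ⟨x, Metric.mem_ball_self (hρ x)⟩, fun x => ?_, ?_⟩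
  · rw [← hΓ x x (Metric.mem_ball_self (hρ x)), hGh]
  · exact tendstoLocallyUniformlyOn_iUnion (fun x => Metric.isOpen_ball) fun x =>
      ((hlim x).congr_right fun z hz => hΓ x z hz).tendstoLocallyUniformlyOn

/-- The entire function of `exists_entire_universal` has translates converging to any given real
analytic function on the line. -/
theorem exists_strictMono_translates_tendsto {F : ℂ → ℂ}
    (hF : ∀ u : ℂ → ℂ, StripDecay u → ∀ R ε : ℝ, 0 < ε →
      ∃ᶠ n : ℕ in atTop, ∀ z : ℂ, ‖z‖ ≤ R → ‖F (z + n) - u z‖ ≤ ε)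
    {h : ℝ → ℝ} (hh : ∀ x, AnalyticAt ℝ h x) :
    ∃ n : ℕ → ℕ, StrictMono n ∧ ∃ (Ω : Set ℂ) (G : ℂ → ℂ), IsOpen Ω ∧
      (∀ x : ℝ, (x : ℂ) ∈ Ω) ∧ (∀ x : ℝ, G x = h x) ∧
        TendstoLocallyUniformlyOn (fun k z => F (z + n k)) G atTop Ω := by
  obtain ⟨u, hu, Ω, G, hΩ, hxΩ, hGh, hlim⟩ := exists_stripDecay_tendstoLocallyUniformlyOn hh
  obtain ⟨n, hn, hFn⟩ := extraction_forall_of_frequently fun k : ℕ =>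
    hF (u k) (hu k) k (1 / ((k : ℝ) + 1)) (by positivity)
  refine ⟨n, hn, Ω, G, hΩ, hxΩ, hGh, ?_⟩
  rw [Metric.tendstoLocallyUniformlyOn_iff] at hlim ⊢
  intro ε hε z hz
  obtain ⟨t, ht, hev⟩ := hlim (ε / 2) (half_pos hε) z hz
  refine ⟨t ∩ Metric.ball z 1,
    inter_mem ht (mem_nhdsWithin_of_mem_nhds (Metric.ball_mem_nhds z one_pos)), ?_⟩
  filter_upwards [hev, eventually_ge_atTop ⌈‖z‖ + 1⌉₊,
    tendsto_one_div_add_atTop_nhds_zero_nat.eventually (gt_mem_nhds (half_pos hε))]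
    with k hk hk1 hk2 w hw
  have h1 : ‖w‖ ≤ k := by
    refine le_trans ?_ (Nat.ceil_le.mp hk1)
    have := norm_le_norm_add_norm_sub' w z
    have := mem_ball_iff_norm.mp hw.2
    linarith
  have h2 := hFn k w h1
  have h3 := hk w hw.1
  have h4 := dist_triangle_right (G w) (F (w + n k)) (u k w)
  rw [dist_eq_norm (F _)] at h4
  linarith

/-- The coordinate on `(0,1)` in which squaring becomes translation by one. -/
noncomputable def squaringCoord (x : ℝ) : ℝ := Real.log (-Real.log x) / Real.log 2

/-- Complex extension of `squaringCoord`. -/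
noncomputable def complexSquaringCoord (z : ℂ) : ℂ :=
  Complex.log (-Complex.log z) / (Real.log 2 : ℝ)

theorem complexSquaringCoord_ofReal {x : ℝ} (hx : x ∈ Set.Ioo (0 : ℝ) 1) :
    complexSquaringCoord x = squaringCoord x := by
  rw [complexSquaringCoord, squaringCoord, ← Complex.ofReal_log hx.1.le, ← Complex.ofReal_neg,
    ← Complex.ofReal_log (neg_nonneg.mpr (Real.log_neg hx.1 hx.2).le), Complex.ofReal_div]

theorem squaringCoord_pow {x : ℝ} (hx : x ∈ Set.Ioo (0 : ℝ) 1) (n : ℕ) :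
    squaringCoord (x ^ 2 ^ n) = squaringCoord x + n := by
  have h1 := Real.log_neg hx.1 hx.2
  have h2 : Real.log 2 ≠ 0 := (Real.log_pos one_lt_two).ne'
  rw [squaringCoord, squaringCoord, Real.log_pow, ← mul_neg, Nat.cast_pow, Nat.cast_ofNat,
    Real.log_mul (by positivity) (by linarith), Real.log_pow]
  field_simp
  ring

theorem exp_neg_exp_squaringCoord {x : ℝ} (hx : x ∈ Set.Ioo (0 : ℝ) 1) :
    Real.exp (-Real.exp (squaringCoord x * Real.log 2)) = x := by
  rw [squaringCoord, div_mul_cancel₀ _ (Real.log_pos one_lt_two).ne',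
    Real.exp_log (neg_pos.mpr (Real.log_neg hx.1 hx.2)), neg_neg, Real.exp_log hx.1]

theorem analyticAt_squaringCoord {x : ℝ} (hx : x ∈ Set.Ioo (0 : ℝ) 1) :
    AnalyticAt ℝ squaringCoord x :=
  ((analyticAt_log hx.1).neg.log (neg_pos.mpr (Real.log_neg hx.1 hx.2))).div analyticAt_const
    (Real.log_pos one_lt_two).ne'

/-- The complex points at which `complexSquaringCoord` avoids the branch cuts of the logarithm. -/
def squaringCoordDomain : Set ℂ :=
  Complex.slitPlane ∩ (fun z => -Complex.log z) ⁻¹' Complex.slitPlane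

theorem isOpen_squaringCoordDomain : IsOpen squaringCoordDomain :=
  ContinuousOn.isOpen_inter_preimage (fun _ hz => (continuousAt_clog hz).neg.continuousWithinAt)
    Complex.isOpen_slitPlane Complex.isOpen_slitPlane

theorem ofReal_mem_squaringCoordDomain {x : ℝ} (hx : x ∈ Set.Ioo (0 : ℝ) 1) :
    (x : ℂ) ∈ squaringCoordDomain := by
  refine ⟨Complex.ofReal_mem_slitPlane.mpr hx.1, ?_⟩
  rw [Set.mem_preimage, ← Complex.ofReal_log hx.1.le, ← Complex.ofReal_neg,
    Complex.ofReal_mem_slitPlane]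
  exact neg_pos.mpr (Real.log_neg hx.1 hx.2)

theorem differentiableOn_complexSquaringCoord :
    DifferentiableOn ℂ complexSquaringCoord squaringCoordDomain := fun _ hz =>
  (((Complex.differentiableAt_log hz.1).neg.clog hz.2).div_const _).differentiableWithinAt

/-- The composition operator `C_φ`, `φ(z) = z²`, is sequentially hypercyclic on
the space `𝒜((0,1))` of real analytic functions on `(0,1)`: there is a real
analytic `f` on `(0,1)` such that for every real analytic `g` on `(0,1)` there
is a strictly increasing sequence `(n_k)` with `f(x^(2^{n_k})) → g(x)` in the
topology of `𝒜((0,1))`.  Convergence in `𝒜((0,1))` is rendered as: for every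
compact `K ⊆ (0,1)` there is an open complex neighbourhood `U` of `K` and
holomorphic functions `F_k, G` on `U` extending the `f ∘ φ^{n_k}` and `g`,
with `F_k → G` locally uniformly on `U`. -/
theorem stmt_10 :
    ∃ f : ℝ → ℝ, (∀ x ∈ Set.Ioo (0 : ℝ) 1, AnalyticAt ℝ f x) ∧
      ∀ g : ℝ → ℝ, (∀ x ∈ Set.Ioo (0 : ℝ) 1, AnalyticAt ℝ g x) →
        ∃ n : ℕ → ℕ, StrictMono n ∧
          ∀ K : Set ℝ, IsCompact K → K ⊆ Set.Ioo (0 : ℝ) 1 →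
            ∃ U : Set ℂ, IsOpen U ∧ (∀ x ∈ K, (x : ℂ) ∈ U) ∧
              ∃ (F : ℕ → ℂ → ℂ) (G : ℂ → ℂ),
                (∀ k, DifferentiableOn ℂ (F k) U) ∧ DifferentiableOn ℂ G U ∧
                (∀ k, ∀ x ∈ K, F k (x : ℂ) = (f (x ^ 2 ^ n k) : ℂ)) ∧
                (∀ x ∈ K, G (x : ℂ) = (g x : ℂ)) ∧
                TendstoLocallyUniformlyOn F G atTop U := by
  obtain ⟨F, hF, hFim, hFuniv⟩ := exists_entire_universal
  refine ⟨fun x => (F (squaringCoord x)).re, fun x hx => ?_, fun g hg => ?_⟩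
  · exact (hF.analyticAt _).re_ofReal.comp (analyticAt_squaringCoord hx)
  have hh : ∀ t, AnalyticAt ℝ (fun t => g (Real.exp (-Real.exp (t * Real.log 2)))) t := fun t =>
    AnalyticAt.comp (g := g) (hg _ ⟨Real.exp_pos _, Real.exp_lt_one_iff.mpr (neg_lt_zero.mpr
      (Real.exp_pos _))⟩) (analyticAt_id.mul analyticAt_const).rexp.neg.rexp
  obtain ⟨n, hn, Ω, G, hΩ, hxΩ, hGh, hlim⟩ := exists_strictMono_translates_tendsto hFuniv hh
  let U : Set ℂ := squaringCoordDomain ∩ complexSquaringCoord ⁻¹' Ω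
  have hdiff : DifferentiableOn ℂ complexSquaringCoord U :=
    differentiableOn_complexSquaringCoord.mono Set.inter_subset_left
  have hU : IsOpen U := differentiableOn_complexSquaringCoord.continuousOn.isOpen_inter_preimage
    isOpen_squaringCoordDomain hΩ
  have hFdiff : ∀ k, DifferentiableOn ℂ (fun z => F (complexSquaringCoord z + n k)) U := fun k =>
    hF.comp_differentiableOn (hdiff.add_const _)
  have hFlim : TendstoLocallyUniformlyOn (fun k z => F (complexSquaringCoord z + n k))
      (fun z => G (complexSquaringCoord z)) atTop U :=
    hlim.comp complexSquaringCoord (fun z hz => hz.2) hdiff.continuousOn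
  refine ⟨n, hn, fun K _ hK => ⟨U, hU, fun x hx => ⟨ofReal_mem_squaringCoordDomain (hK hx), ?_⟩,
    fun k z => F (complexSquaringCoord z + n k), fun z => G (complexSquaringCoord z), hFdiff,
    hFlim.differentiableOn (Eventually.of_forall hFdiff) hU, fun k x hx => ?_, fun x hx => ?_,
    hFlim⟩⟩
  · rw [Set.mem_preimage, complexSquaringCoord_ofReal (hK hx)]
    exact hxΩ _
  · dsimp only
    rw [complexSquaringCoord_ofReal (hK hx), squaringCoord_pow (hK hx)]
    apply Complex.ext
    · simp
    · simpa using hFim (squaringCoord x + n k)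
  · dsimp only
    rw [complexSquaringCoord_ofReal (hK hx), hGh, exp_neg_exp_squaringCoord (hK hx)]
end

section
/- Any real analytic diffeomorphism φ : ℝ → ℝ without fixed points is real-analytically conjugate to the translation x ↦ x + 1 or x ↦ x − 1: there exists a real analytic diffeomorphism h : ℝ → ℝ such that h ∘ φ ∘ h⁻¹ (x) = x ± 1 for all x ∈ ℝ. -/
section

open Filter Topology Set

/-- A real analytic germ extends to a holomorphic germ. -/
theorem AnalyticAt.exists_complex_extension_s11 {f : ℝ → ℝ} {x₀ : ℝ} (hf : AnalyticAt ℝ f x₀) :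
    ∃ F : ℂ → ℂ, AnalyticAt ℂ F x₀ ∧ ∀ᶠ x : ℝ in 𝓝 x₀, F x = f x := by
  obtain ⟨p, hp⟩ := hf
  rw [hasFPowerSeriesAt_iff] at hp
  obtain ⟨r, hr, hball⟩ := Metric.eventually_nhds_iff.1 hp
  have hs : Summable fun n => |(r / 2) ^ n * p.coeff n| := by
    have := (hball (y := r / 2) (by simp [abs_of_pos hr]; linarith)).summable.abs
    simpa using this
  refine ⟨fun z => ∑' n, (z - x₀) ^ n * (p.coeff n : ℂ),
    ⟨FormalMultilinearSeries.ofScalars ℂ fun n => (p.coeff n : ℂ), ?_⟩, ?_⟩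
  · rw [hasFPowerSeriesAt_iff]
    filter_upwards [Metric.ball_mem_nhds (0 : ℂ) (half_pos hr)] with z hz
    have hz' : ‖z‖ < r / 2 := by simpa using hz
    have : Summable fun n => z ^ n * (p.coeff n : ℂ) := by
      refine Summable.of_norm_bounded hs fun n => ?_
      rw [norm_mul, norm_pow, Complex.norm_real, abs_mul, abs_pow, abs_of_pos (half_pos hr),
        Real.norm_eq_abs]
      gcongr
    simpa [FormalMultilinearSeries.coeff_ofScalars] using this.hasSum
  · have hx : Tendsto (fun x : ℝ => x - x₀) (𝓝 x₀) (𝓝 0) := by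
      simpa using (continuous_id.sub continuous_const).tendsto (x := x₀) (f := fun x : ℝ => x - x₀)
    filter_upwards [hx.eventually hp] with x hx
    have := (Complex.hasSum_ofReal (f := fun n => (x - x₀) ^ n • p.coeff n)).2 hx
    simpa using this.tsum_eq

/-- An antiderivative of a real analytic function is real analytic. -/
theorem analyticAt_of_eventually_hasDerivAt {f f' : ℝ → ℝ} {x₀ : ℝ} (hf' : AnalyticAt ℝ f' x₀)
    (hf : ∀ᶠ x in 𝓝 x₀, HasDerivAt f (f' x) x) : AnalyticAt ℝ f x₀ := by
  obtain ⟨F, hF, hFf⟩ := hf'.exists_complex_extension_s11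
  obtain ⟨r, hr, hball⟩ := Metric.eventually_nhds_iff_ball.1
    (hF.eventually_analyticAt)
  obtain ⟨G, hG⟩ := DifferentiableOn.isExactOn_ball
    (fun z hz => (hball z hz).differentiableAt.differentiableWithinAt)
  have hGa : AnalyticAt ℂ G x₀ := by
    refine DifferentiableOn.analyticAt (s := Metric.ball (x₀ : ℂ) r)
      (fun z hz => (hG z hz).differentiableAt.differentiableWithinAt) (Metric.ball_mem_nhds _ hr)
  have hd : ∀ᶠ x : ℝ in 𝓝 x₀, HasDerivAt (fun x : ℝ => f x - (G x).re) 0 x := by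
    filter_upwards [hf, hFf, Metric.ball_mem_nhds x₀ hr] with x h1 h2 h3
    have h4 := (hG (x : ℂ) ((Complex.isometry_ofReal.dist_eq x x₀).trans_lt h3)).real_of_complex
    rw [h2, Complex.ofReal_re] at h4
    have h5 := h1.sub h4
    rw [sub_self] at h5
    exact h5
  obtain ⟨s, hs, hsball⟩ := Metric.eventually_nhds_iff_ball.1 hd
  refine ((hGa.re_ofReal).add (analyticAt_const (v := f x₀ - (G x₀).re))).congr ?_
  filter_upwards [Metric.ball_mem_nhds x₀ hs] with x hx
  have := (convex_ball x₀ s).is_const_of_fderivWithin_eq_zero (𝕜 := ℝ)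
    (f := fun x : ℝ => f x - (G x).re)
    (fun y hy => (hsball y hy).differentiableAt.differentiableWithinAt)
    (fun y hy => by
      rw [fderivWithin_of_isOpen Metric.isOpen_ball hy]
      ext; simpa using (hsball y hy).deriv) hx (Metric.mem_ball_self hs)
  simp only [Pi.add_apply] at *
  linarith

/-- Fredholm equations of the second kind with small continuous kernels are solvable. -/
theorem exists_solution_integral_equation {a b c M : ℝ} (hab : a ≤ b) (hbc : b ≤ c)
    (hM : M * (c - a) ≤ 1 / 2) {f : ℝ → ℂ} (hf : Continuous f) {B : ℝ} (hB : ∀ x, ‖f x‖ ≤ B)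
    {k l : ℝ → ℝ → ℂ} (hk : Continuous (Function.uncurry k))
    (hl : Continuous (Function.uncurry l)) (hkM : ∀ x y, ‖k x y‖ ≤ M) (hlM : ∀ x y, ‖l x y‖ ≤ M) :
    ∃ u : ℝ → ℂ, Continuous u ∧
      ∀ x, u x = f x + ((∫ y in a..b, u y * k x y) + ∫ y in b..c, u y * l x y) := by
  have hcont (u : BoundedContinuousFunction ℝ ℂ) (p q : ℝ) {k : ℝ → ℝ → ℂ}
      (hk : Continuous (Function.uncurry k)) : Continuous fun x => ∫ y in p..q, u y * k x y := by
    apply intervalIntegral.continuous_parametric_intervalIntegral_of_continuous'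
    exact (u.continuous.comp continuous_snd).mul hk
  have hint (u : BoundedContinuousFunction ℝ ℂ) (p q x : ℝ) {k : ℝ → ℝ → ℂ}
      (hk : Continuous (Function.uncurry k)) :
      IntervalIntegrable (fun y => u y * k x y) MeasureTheory.volume p q :=
    (u.continuous.mul (hk.comp (by fun_prop : Continuous fun y : ℝ => (x, y)))).intervalIntegrable
      _ _
  have hbd (u : BoundedContinuousFunction ℝ ℂ) (x : ℝ) :
      ‖(∫ y in a..b, u y * k x y) + ∫ y in b..c, u y * l x y‖ ≤ 1 / 2 * ‖u‖ := by
    have h1 : ‖∫ y in a..b, u y * k x y‖ ≤ ‖u‖ * M * |b - a| :=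
      intervalIntegral.norm_integral_le_of_norm_le_const fun y _ => by
        rw [norm_mul]
        exact mul_le_mul (u.norm_coe_le_norm y) (hkM x y) (norm_nonneg _) (norm_nonneg _)
    have h2 : ‖∫ y in b..c, u y * l x y‖ ≤ ‖u‖ * M * |c - b| :=
      intervalIntegral.norm_integral_le_of_norm_le_const fun y _ => by
        rw [norm_mul]
        exact mul_le_mul (u.norm_coe_le_norm y) (hlM x y) (norm_nonneg _) (norm_nonneg _)
    rw [abs_of_nonneg (sub_nonneg.2 hab)] at h1
    rw [abs_of_nonneg (sub_nonneg.2 hbc)] at h2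
    calc _ ≤ ‖u‖ * M * (b - a) + ‖u‖ * M * (c - b) := (norm_add_le _ _).trans (add_le_add h1 h2)
      _ = (M * (c - a)) * ‖u‖ := by ring
      _ ≤ _ := by gcongr
  let T (u : BoundedContinuousFunction ℝ ℂ) : BoundedContinuousFunction ℝ ℂ :=
    BoundedContinuousFunction.ofNormedAddCommGroup
      (fun x => f x + ((∫ y in a..b, u y * k x y) + ∫ y in b..c, u y * l x y))
      (hf.add ((hcont u a b hk).add (hcont u b c hl))) (B + 1 / 2 * ‖u‖)
      (fun x => (norm_add_le _ _).trans (add_le_add (hB x) (hbd u x)))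
  have hT : ContractingWith (1 / 2) T := by
    refine ⟨by norm_num, LipschitzWith.of_dist_le_mul fun u v => ?_⟩
    rw [BoundedContinuousFunction.dist_le (by positivity)]
    intro x
    have := hbd (u - v) x
    rw [← dist_eq_norm] at this
    refine le_trans (le_of_eq ?_) (this.trans (le_of_eq (by simp)))
    simp only [T, BoundedContinuousFunction.coe_ofNormedAddCommGroup,
      BoundedContinuousFunction.coe_sub, Pi.sub_apply, sub_mul]
    rw [intervalIntegral.integral_sub (hint u a b x hk) (hint v a b x hk),
      intervalIntegral.integral_sub (hint u b c x hl) (hint v b c x hl), dist_eq_norm]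
    congr 1
    ring
  let w : BoundedContinuousFunction ℝ ℂ := ContractingWith.fixedPoint T hT
  exact ⟨w, w.continuous, fun x => (congrArg (fun u : BoundedContinuousFunction ℝ ℂ => u x)
    hT.fixedPoint_isFixedPt).symm⟩

/-- Cauchy-type integrals are holomorphic off the curve. -/
theorem differentiableOn_integral_div_sub {g e : ℝ → ℂ} (hg : Continuous g) (he : Continuous e)
    (a b : ℝ) : DifferentiableOn ℂ (fun z => ∫ θ in a..b, g θ / (e θ - z))
      {z | ∀ θ ∈ uIcc a b, e θ ≠ z} := by
  intro z hz
  refine DifferentiableAt.differentiableWithinAt ?_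
  have hK : IsCompact (e '' uIcc a b) := isCompact_uIcc.image he
  have hzK : (e '' uIcc a b)ᶜ ∈ 𝓝 z :=
    hK.isClosed.isOpen_compl.mem_nhds (by rintro ⟨θ, h, h'⟩; exact hz θ h h')
  obtain ⟨r, hr, hball⟩ := Metric.mem_nhds_iff.1 hzK
  have hfar : ∀ w ∈ Metric.ball z (r / 2), ∀ θ ∈ uIcc a b, r / 2 ≤ ‖e θ - w‖ := by
    intro w hw θ hθ
    by_contra! h
    refine hball (a := e θ) ?_ ⟨θ, hθ, rfl⟩
    rw [Metric.mem_ball] at hw ⊢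
    rw [← dist_eq_norm] at h
    linarith [dist_triangle (e θ) w z]
  have hne : ∀ w ∈ Metric.ball z (r / 2), ∀ θ ∈ uIcc a b, e θ - w ≠ 0 := fun w hw θ hθ h => by
    have := hfar w hw θ hθ
    rw [h, norm_zero] at this
    linarith
  have hcont : ∀ w ∈ Metric.ball z (r / 2), ContinuousOn (fun θ => g θ / (e θ - w)) (uIcc a b) :=
    fun w hw => hg.continuousOn.div (he.continuousOn.sub continuousOn_const) (hne w hw)
  have hzz := Metric.mem_ball_self (x := z) (half_pos hr)
  refine (intervalIntegral.hasDerivAt_integral_of_dominated_loc_of_deriv_le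
    (F' := fun w θ => g θ / (e θ - w) ^ 2) (bound := fun θ => ‖g θ‖ / (r / 2) ^ 2)
    (Metric.ball_mem_nhds z (half_pos hr)) ?_ ?_ ?_ ?_ ?_ ?_).2.differentiableAt
  · filter_upwards [Metric.ball_mem_nhds z (half_pos hr)] with w hw
    exact (((hcont w hw).mono uIoc_subset_uIcc).aestronglyMeasurable measurableSet_uIoc)
  · exact (hcont z hzz).intervalIntegrable
  · refine ContinuousOn.aestronglyMeasurable ?_ measurableSet_uIoc
    exact hg.continuousOn.div ((he.continuousOn.sub continuousOn_const).pow 2)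
      fun θ hθ => pow_ne_zero 2 (hne z hzz θ (uIoc_subset_uIcc hθ))
  · refine Filter.Eventually.of_forall fun θ hθ w hw => ?_
    rw [norm_div, norm_pow]
    have := hfar w hw θ (uIoc_subset_uIcc hθ)
    gcongr
  · exact (by fun_prop : Continuous fun θ => ‖g θ‖ / (r / 2) ^ 2).intervalIntegrable _ _
  · refine Filter.Eventually.of_forall fun θ hθ w hw => ?_
    have h0 := hne w hw θ (uIoc_subset_uIcc hθ)
    have h1 : HasDerivAt (fun w => e θ - w) (-1) w := by
      simpa using (hasDerivAt_id w).const_sub (e θ)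
    refine ((hasDerivAt_const w (g θ)).fun_div h1 h0).congr_deriv ?_
    ring

open Real in
/-- The additive Cousin problem behind the cohomological equation: the jump of a Cauchy-type integral
across a small circle, corrected by the values of its two halves away from the circle, can be
prescribed. The density of the Cauchy integral solves a Fredholm equation whose kernel is small when
the circle is. -/
theorem exists_holomorphic_splitting {Φ Ψ A : ℂ → ℂ} (hΦ : AnalyticAt ℂ Φ 0)
    (hΨ : AnalyticAt ℂ Ψ 0) (hA : AnalyticAt ℂ A 0) (hΦ₀ : Φ 0 ≠ 0) (hΨ₀ : Ψ 0 ≠ 0) :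
    ∃ P Q : ℂ → ℂ, (∀ x : ℝ, 0 ≤ x → AnalyticAt ℂ P x) ∧ (∀ x : ℝ, x ≤ 0 → AnalyticAt ℂ Q x) ∧
      ∀ᶠ z in 𝓝 0, P (Φ z) + Q z - (P z + Q (Ψ z)) = A z := by
  obtain ⟨m, hm, hmΦ, hmΨ⟩ : ∃ m : ℝ, 0 < m ∧ 3 * m < ‖Φ 0‖ ∧ 3 * m < ‖Ψ 0‖ := by
    have h1 := norm_pos_iff.2 hΦ₀
    have h2 := norm_pos_iff.2 hΨ₀
    refine ⟨min ‖Φ 0‖ ‖Ψ 0‖ / 4, by positivity, ?_, ?_⟩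
    · linarith [min_le_left ‖Φ 0‖ ‖Ψ 0‖]
    · linarith [min_le_right ‖Φ 0‖ ‖Ψ 0‖]
  obtain ⟨R, hR, hball⟩ := Metric.eventually_nhds_iff_ball.1
    (((hΦ.eventually_analyticAt.and hΨ.eventually_analyticAt).and hA.eventually_analyticAt).and
      ((hΦ.continuousAt.norm.eventually_const_lt hmΦ).and
        (hΨ.continuousAt.norm.eventually_const_lt hmΨ)))
  obtain ⟨ε, hε, hεR, hεm⟩ : ∃ ε : ℝ, 0 < ε ∧ ε < R ∧ ε ≤ m :=
    ⟨min (R / 2) m, by positivity, (min_le_left _ _).trans_lt (half_lt_self hR), min_le_right _ _⟩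
  let e : ℝ → ℂ := circleMap 0 ε
  have he : Continuous e := continuous_circleMap 0 ε
  have hen (θ : ℝ) : ‖e θ‖ = ε := by simp [e, abs_of_pos hε]
  have heR (θ : ℝ) : e θ ∈ Metric.ball (0 : ℂ) R := by rw [mem_ball_zero_iff, hen]; exact hεR
  have hdist {w : ℂ} (hw : 3 * m < ‖w‖) (θ : ℝ) : 2 * m ≤ ‖e θ - w‖ := by
    have := norm_sub_norm_le w (e θ)
    rw [hen, norm_sub_rev] at this
    linarith
  have hne {w : ℂ} (hw : 3 * m < ‖w‖) (θ : ℝ) : e θ - w ≠ 0 := fun h => by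
    have := hdist hw θ
    rw [h, norm_zero] at this
    linarith
  have hkernel {F : ℂ → ℂ} (hF : ∀ z ∈ Metric.ball (0 : ℂ) R, AnalyticAt ℂ F z)
      (hF3 : ∀ z ∈ Metric.ball (0 : ℂ) R, 3 * m < ‖F z‖) :
      Continuous (Function.uncurry fun x y : ℝ => e y / (2 * π) / (e y - F (e x))) ∧
        ∀ x y : ℝ, ‖e y / (2 * π) / (e y - F (e x))‖ ≤ 1 / (4 * π) := by
    have hFe : Continuous fun x => F (e x) := continuous_iff_continuousAt.2 fun x =>
      (hF _ (heR x)).continuousAt.comp he.continuousAt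
    refine ⟨?_, fun x y => ?_⟩
    · refine Continuous.div ((he.comp continuous_snd).div_const _)
        ((he.comp continuous_snd).sub (hFe.comp continuous_fst))
        fun p => hne (hF3 _ (heR p.1)) p.2
    · rw [norm_div, norm_div, hen]
      have h1 : ‖(2 * π : ℂ)‖ = 2 * π := by simp [abs_of_pos pi_pos]
      rw [h1]
      calc ε / (2 * π) / ‖e y - F (e x)‖ ≤ m / (2 * π) / (2 * m) := by
            gcongr
            exact hdist (hF3 _ (heR x)) y
        _ = 1 / (4 * π) := by field_simp; norm_num
  obtain ⟨hk, hkM⟩ := hkernel (fun z hz => (hball z hz).1.1.2) (fun z hz => (hball z hz).2.2)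
  obtain ⟨hl, hlM⟩ := hkernel (fun z hz => (hball z hz).1.1.1) (fun z hz => (hball z hz).2.1)
  have hAe : Continuous fun x => A (e x) := continuous_iff_continuousAt.2 fun x =>
      (hball _ (heR x)).1.2.continuousAt.comp he.continuousAt
  obtain ⟨B, hB⟩ : ∃ B, ∀ x, ‖A (e x)‖ ≤ B := by
    obtain ⟨B, hB⟩ := (isCompact_sphere (0 : ℂ) ε).exists_bound_of_continuousOn (f := A)
      fun z hz => (hball z (by
        rw [mem_ball_zero_iff, mem_sphere_zero_iff_norm.1 hz]
        exact hεR)).1.2.continuousAt.continuousWithinAt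
    exact ⟨B, fun x => hB _ (mem_sphere_zero_iff_norm.2 (hen x))⟩
  have hpi := pi_pos
  obtain ⟨u, hu, hu_eq⟩ := exists_solution_integral_equation (a := -(π / 2)) (b := π / 2)
    (c := 3 * π / 2) (by linarith) (by linarith) (le_of_eq (by field_simp; norm_num)) hAe hB
    hk hl hkM hlM
  let g : ℝ → ℂ := fun θ => u θ * (e θ / (2 * π))
  have hg : Continuous g := hu.mul (he.div_const _)
  let J : ℝ → ℝ → ℂ → ℂ := fun a b z => ∫ θ in a..b, g θ / (e θ - z)
  have hJ (a b : ℝ) (z : ℂ) (hz : ∀ θ ∈ uIcc a b, e θ ≠ z) : AnalyticAt ℂ (J a b) z := by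
    refine (differentiableOn_integral_div_sub hg he a b).analyticAt (IsOpen.mem_nhds ?_ hz)
    have : {z | ∀ θ ∈ uIcc a b, e θ ≠ z} = (e '' uIcc a b)ᶜ := by ext; simp
    rw [this]
    exact (isCompact_uIcc.image he).isClosed.isOpen_compl
  let U : ℂ → ℂ := fun z =>
    A z + (J (-(π / 2)) (π / 2) (Ψ z) + J (π / 2) (3 * π / 2) (Φ z))
  have hU (z : ℂ) (hz : z ∈ Metric.ball (0 : ℂ) R) : AnalyticAt ℂ U z := by
    obtain ⟨⟨⟨h1, h2⟩, h3⟩, h4, h5⟩ := hball z hz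
    exact h3.add (((hJ _ _ _ fun θ _ => sub_ne_zero.1 (hne h5 θ)).comp h2).add
      ((hJ _ _ _ fun θ _ => sub_ne_zero.1 (hne h4 θ)).comp h1))
  have hUu (θ : ℝ) : u θ = U (e θ) := by
    rw [hu_eq]
    simp only [U, J, g, mul_div_assoc]
  have hre (θ : ℝ) : (e θ).re = ε * cos θ := by simp [e, circleMap, Complex.exp_ofReal_mul_I_re]
  have hoff (θ x : ℝ) (hx : cos θ * x ≤ 0) : e θ ≠ x := fun h => by
    have h1 := hre θ
    rw [h, Complex.ofReal_re] at h1
    have h2 : x = 0 := by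
      rw [h1] at hx ⊢
      have : cos θ = 0 := by
        by_contra hc
        have := mul_pos hε (mul_self_pos.2 hc)
        linarith
      rw [this, mul_zero]
    have h3 := hen θ
    rw [h, h2] at h3
    simp at h3
    linarith
  refine ⟨fun z => -J (π / 2) (3 * π / 2) z, J (-(π / 2)) (π / 2), fun x hx => ?_, fun x hx => ?_,
    ?_⟩
  · refine (hJ _ _ _ fun θ hθ => hoff θ x (mul_nonpos_of_nonpos_of_nonneg ?_ hx)).neg
    rw [uIcc_of_le (by linarith)] at hθ
    exact cos_nonpos_of_pi_div_two_le_of_le hθ.1 (by linarith [hθ.2])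
  · refine hJ _ _ _ fun θ hθ => hoff θ x (mul_nonpos_of_nonneg_of_nonpos ?_ hx)
    rw [uIcc_of_le (by linarith)] at hθ
    exact cos_nonneg_of_neg_pi_div_two_le_of_le hθ.1 hθ.2
  · filter_upwards [Metric.ball_mem_nhds (0 : ℂ) hε] with z hz
    have hnez (θ : ℝ) : e θ - z ≠ 0 := fun h => by
      rw [mem_ball_zero_iff, ← sub_eq_zero.1 h, hen] at hz
      exact hz.false
    have hcont : Continuous fun θ => g θ / (e θ - z) := hg.div (he.sub continuous_const) hnez
    have hcauchy : J (-(π / 2)) (π / 2) z + J (π / 2) (3 * π / 2) z = U z := by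
      have hper : Function.Periodic (fun θ => g θ / (e θ - z)) (2 * π) := by
        have : Function.Periodic e (2 * π) := periodic_circleMap 0 ε
        intro θ
        simp only [g, hUu, this θ]
      have hd : DiffContOnCl ℂ U (Metric.ball 0 ε) := by
        refine DifferentiableOn.diffContOnCl fun w hw => ?_
        rw [closure_ball _ hε.ne'] at hw
        exact (hU w (Metric.closedBall_subset_ball hεR hw)).differentiableAt.differentiableWithinAt
      have hc := hd.circleIntegral_sub_inv_smul hz
      simp only [J]
      rw [intervalIntegral.integral_add_adjacent_intervals (hcont.intervalIntegrable _ _)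
        (hcont.intervalIntegrable _ _)]
      have h32 : 3 * π / 2 = -(π / 2) + 2 * π := by ring
      rw [h32, hper.intervalIntegral_add_eq (-(π / 2)) 0, zero_add]
      have h2pi : (2 * π * Complex.I : ℂ) ≠ 0 := Complex.two_pi_I_ne_zero
      apply mul_left_cancel₀ h2pi
      rw [smul_eq_mul] at hc
      rw [← hc, circleIntegral, ← intervalIntegral.integral_const_mul]
      refine intervalIntegral.integral_congr fun θ _ => ?_
      have hpi' : (π : ℂ) ≠ 0 := Complex.ofReal_ne_zero.2 pi_ne_zero
      have := hnez θ
      simp only [g, hUu, deriv_circleMap, smul_eq_mul]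
      change 2 * π * Complex.I * (U (e θ) * (e θ / (2 * π)) / (e θ - z)) =
        e θ * Complex.I * ((e θ - z)⁻¹ * U (e θ))
      field_simp
    simp only [U] at hcauchy
    linear_combination hcauchy

theorem StrictMono.deriv_pos_of_leftInverse {f g : ℝ → ℝ} (hf : Differentiable ℝ f)
    (hg : Differentiable ℝ g) (hgf : Function.LeftInverse g f) (hmono : StrictMono f) (x : ℝ) :
    0 < deriv f x := by
  refine hmono.monotone.deriv_nonneg.lt_of_ne' fun h => ?_
  have h1 : HasDerivAt (g ∘ f) (deriv g (f x) * deriv f x) x :=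
    (hg _).hasDerivAt.comp x (hf x).hasDerivAt
  rw [hgf.comp_eq_id, h, mul_zero] at h1
  exact zero_ne_one (h1.unique (hasDerivAt_id x))

/-- The cohomological equation `v ∘ e - v = a` is solvable near the fundamental domain `[0, e 0]`. -/
theorem exists_analytic_cohomological_solution (e : Equiv.Perm ℝ) (he : ∀ x, AnalyticAt ℝ e x)
    (he' : ∀ x, AnalyticAt ℝ (e⁻¹ : Equiv.Perm ℝ) x) (hmono : StrictMono e) (h0 : 0 < e 0)
    {a : ℝ → ℝ} (ha : AnalyticAt ℝ a 0) :
    ∃ v : ℝ → ℝ, (∀ x ∈ Icc 0 (e 0), AnalyticAt ℝ v x) ∧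
      ∀ᶠ x in 𝓝 0, v (e x) = v x + a x := by
  obtain ⟨Φ, hΦ, hΦe⟩ := (he 0).exists_complex_extension_s11
  obtain ⟨Ψ, hΨ, hΨe⟩ := (he' 0).exists_complex_extension_s11
  obtain ⟨A, hA, hAa⟩ := ha.exists_complex_extension_s11
  have hinv0 : (e⁻¹ : Equiv.Perm ℝ) 0 ≠ 0 := fun h => by
    have h1 := e.apply_symm_apply 0
    rw [← Equiv.Perm.inv_def, h] at h1
    exact h0.ne' h1
  have hΦ0 := hΦe.self_of_nhds
  have hΨ0 := hΨe.self_of_nhds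
  rw [Complex.ofReal_zero] at hΦ hΨ hA hΦ0 hΨ0
  obtain ⟨P, Q, hP, hQ, hPQ⟩ := exists_holomorphic_splitting hΦ hΨ hA
    (by rw [hΦ0]; exact_mod_cast h0.ne') (by rw [hΨ0]; exact_mod_cast hinv0)
  refine ⟨fun x => (P x).re + (Q ((e⁻¹ : Equiv.Perm ℝ) x : ℝ)).re, fun x hx => ?_, ?_⟩
  · have h1 : (e⁻¹ : Equiv.Perm ℝ) x ≤ 0 := by
      rw [← hmono.le_iff_le, Equiv.Perm.inv_def, e.apply_symm_apply]
      exact hx.2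
    exact (hP x hx.1).re_ofReal.add
      (AnalyticAt.comp (g := fun y : ℝ => (Q y).re) (hQ _ h1).re_ofReal (he' x))
  · have hlim : Tendsto (fun x : ℝ => (x : ℂ)) (𝓝 0) (𝓝 0) := by
      simpa using Complex.continuous_ofReal.tendsto 0
    filter_upwards [hlim.eventually hPQ, hΦe, hΨe, hAa] with x h1 h2 h3 h4
    rw [h2, h3, h4] at h1
    have h5 := congrArg Complex.re h1
    simp only [Complex.add_re, Complex.sub_re, Complex.ofReal_re] at h5
    have h6 : (e⁻¹ : Equiv.Perm ℝ) (e x) = x := e.symm_apply_apply x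
    rw [h6]
    linarith

/-- Abel's equation `h ∘ e = h + 1` has an increasing analytic solution near `[0, e 0]`. -/
theorem exists_analytic_abel_solution_near_Icc (e : Equiv.Perm ℝ) (he : ∀ x, AnalyticAt ℝ e x)
    (he' : ∀ x, AnalyticAt ℝ (e⁻¹ : Equiv.Perm ℝ) x) (hmono : StrictMono e) (h0 : 0 < e 0) :
    ∃ h : ℝ → ℝ, (∀ x ∈ Icc 0 (e 0), AnalyticAt ℝ h x ∧ 0 < deriv h x) ∧
      ∀ᶠ x in 𝓝 0, h (e x) = h x + 1 := by
  have hderiv : ∀ x, 0 < deriv e x := hmono.deriv_pos_of_leftInverse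
    (fun x => (he x).differentiableAt) (fun x => (he' x).differentiableAt) e.symm_apply_apply
  obtain ⟨v, hv, hve⟩ := exists_analytic_cohomological_solution e he he' hmono h0
    (a := fun x => -Real.log (deriv e x))
    ((analyticAt_log (hderiv 0)).comp (he 0).deriv).neg
  obtain ⟨α, β, hα, hβ, hαβ⟩ : ∃ α β : ℝ, α < 0 ∧ e 0 < β ∧ ∀ x ∈ Ioo α β, AnalyticAt ℝ v x := by
    obtain ⟨s, hs, hs'⟩ := Metric.eventually_nhds_iff_ball.1
      (hv 0 (left_mem_Icc.2 h0.le)).eventually_analyticAt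
    obtain ⟨t, ht, ht'⟩ := Metric.eventually_nhds_iff_ball.1
      (hv (e 0) (right_mem_Icc.2 h0.le)).eventually_analyticAt
    refine ⟨-s, e 0 + t, by linarith, by linarith, fun x hx => ?_⟩
    rcases lt_or_ge x 0 with h1 | h1
    · refine hs' x ?_
      rw [Real.ball_eq_Ioo]
      constructor <;> linarith [hx.1]
    rcases lt_or_ge (e 0) x with h2 | h2
    · refine ht' x ?_
      rw [Real.ball_eq_Ioo]
      constructor <;> linarith [hx.2]
    exact hv x ⟨h1, h2⟩
  set w : ℝ → ℝ := fun x => Real.exp (v x) with hw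
  have hwa : ∀ x ∈ Ioo α β, AnalyticAt ℝ w x := fun x hx => (hαβ x hx).rexp'
  have hwc : ContinuousOn w (Ioo α β) := fun x hx => (hwa x hx).continuousAt.continuousWithinAt
  have h0mem : (0 : ℝ) ∈ Ioo α β := ⟨hα, h0.trans hβ⟩
  have hemem : e 0 ∈ Ioo α β := ⟨hα.trans h0, hβ⟩
  have hint : ∀ x ∈ Ioo α β, IntervalIntegrable w MeasureTheory.volume 0 x := fun x hx =>
    (hwc.mono (ordConnected_Ioo.uIcc_subset h0mem hx)).intervalIntegrable
  set p : ℝ → ℝ := fun x => ∫ y in (0 : ℝ)..x, w y with hp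
  have hpd : ∀ x ∈ Ioo α β, HasDerivAt p (w x) x := fun x hx =>
    intervalIntegral.integral_hasDerivAt_right (hint x hx)
      (hwc.stronglyMeasurableAtFilter isOpen_Ioo x hx) (hwa x hx).continuousAt
  have hp0 : p 0 = 0 := intervalIntegral.integral_same
  have hpos : 0 < p (e 0) :=
    intervalIntegral.intervalIntegral_pos_of_pos_on (hint _ hemem) (fun _ _ => Real.exp_pos _) h0
  have hdiff : ∀ᶠ x in 𝓝 0, HasDerivAt (fun x => p (e x) - p x) 0 x := by
    filter_upwards [hve, isOpen_Ioo.mem_nhds h0mem,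
      (he 0).continuousAt.preimage_mem_nhds (isOpen_Ioo.mem_nhds hemem)] with x h1 h2 h3
    have h4 := ((hpd _ h3).comp x (he x).differentiableAt.hasDerivAt).sub (hpd x h2)
    have h5 : w (e x) * deriv e x - w x = 0 := by
      simp only [hw, h1, Real.exp_add, Real.exp_neg, Real.exp_log (hderiv x)]
      field_simp [(hderiv x).ne']
      simp
    rw [h5] at h4
    exact h4
  obtain ⟨s, hs, hs'⟩ := Metric.eventually_nhds_iff_ball.1 hdiff
  refine ⟨fun x => p x / p (e 0), fun x hx => ?_, ?_⟩
  · have hx' : x ∈ Ioo α β := ⟨hα.trans_le hx.1, hx.2.trans_lt hβ⟩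
    refine ⟨(analyticAt_of_eventually_hasDerivAt (hwa x hx') ?_).div_const, ?_⟩
    · filter_upwards [isOpen_Ioo.mem_nhds hx'] with y hy using hpd y hy
    · rw [((hpd x hx').div_const _).deriv]
      exact div_pos (Real.exp_pos _) hpos
  · filter_upwards [Metric.ball_mem_nhds (0 : ℝ) hs] with x hx
    have h1 := Metric.isOpen_ball.is_const_of_deriv_eq_zero
      (convex_ball (0 : ℝ) s).isPreconnected
      (fun y hy => (hs' y hy).differentiableAt.differentiableWithinAt)
      (fun y hy => (hs' y hy).deriv) hx (Metric.mem_ball_self hs)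
    rw [hp0, sub_zero] at h1
    field_simp
    linarith

/-- The group of increasing real analytic diffeomorphisms of `ℝ`. -/
def analyticMonoPerm : Subgroup (Equiv.Perm ℝ) where
  carrier := {e | (∀ x, AnalyticAt ℝ e x) ∧ (∀ x, AnalyticAt ℝ (e⁻¹ : Equiv.Perm ℝ) x) ∧
    StrictMono e}
  mul_mem' {e f} he hf := ⟨fun x => (he.1 _).comp (hf.1 x), fun x => by
    rw [mul_inv_rev]
    exact (hf.2.1 _).comp (he.2.1 x), he.2.2.comp hf.2.2⟩
  one_mem' := ⟨fun _ => analyticAt_id, fun _ => analyticAt_id, strictMono_id⟩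
  inv_mem' {e} he := ⟨he.2.1, by rw [inv_inv]; exact he.1, fun x y hxy => by
    rw [← he.2.2.lt_iff_lt, ← Equiv.Perm.mul_apply, ← Equiv.Perm.mul_apply, mul_inv_cancel]
    exact hxy⟩

theorem exists_le_iterate_of_forall_lt {f : ℝ → ℝ} (hf : Continuous f) (hlt : ∀ x, x < f x)
    (x y : ℝ) : ∃ n : ℕ, y ≤ f^[n] x := by
  have hmono : Monotone fun n => f^[n] x := monotone_nat_of_le_succ fun n => by
    rw [Function.iterate_succ_apply']
    exact (hlt _).le
  rcases tendsto_atTop_of_monotone hmono with h | ⟨l, h⟩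
  · exact (h.eventually_ge_atTop y).exists
  · exact ((hlt l).ne' (isFixedPt_of_tendsto_iterate h hf.continuousAt)).elim

theorem exists_iterate_le_of_forall_lt {f : ℝ → ℝ} (hf : Continuous f) (hlt : ∀ x, f x < x)
    (x y : ℝ) : ∃ n : ℕ, f^[n] x ≤ y := by
  have hanti : Antitone fun n => f^[n] x := antitone_nat_of_succ_le fun n => by
    rw [Function.iterate_succ_apply']
    exact (hlt _).le
  rcases tendsto_atTop_of_antitone hanti with h | ⟨l, h⟩
  · exact (h.eventually_le_atBot y).exists
  · exact ((hlt l).ne (isFixedPt_of_tendsto_iterate h hf.continuousAt)).elim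

/-- Abel's equation `H ∘ e = H + 1` has an increasing analytic solution on `ℝ`. -/
theorem exists_analytic_abel_solution {e : Equiv.Perm ℝ} (he : e ∈ analyticMonoPerm)
    (hlt : ∀ x, x < e x) :
    ∃ H : ℝ → ℝ, (∀ x, AnalyticAt ℝ H x ∧ 0 < deriv H x) ∧ ∀ x, H (e x) = H x + 1 := by
  obtain ⟨h, hh, hab⟩ := exists_analytic_abel_solution_near_Icc e he.1 he.2.1 he.2.2 (hlt 0)
  set s : ℤ → ℝ := fun n => (e ^ n) 0 with hs
  have hs_succ (n : ℤ) : s (n + 1) = e (s n) := by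
    simp only [hs, add_comm n 1, zpow_one_add, Equiv.Perm.mul_apply]
  have hs_mono : StrictMono s := strictMono_int_of_lt_succ fun n => by
    rw [hs_succ]
    exact hlt _
  have hex (x : ℝ) : ∃ n : ℤ, s n ≤ x ∧ x < s (n + 1) := by
    obtain ⟨a, ha⟩ := exists_iterate_le_of_forall_lt (f := (e⁻¹ : Equiv.Perm ℝ))
      (continuous_iff_continuousAt.2 fun x => (he.2.1 x).continuousAt)
      (fun x => by simpa using hlt (e⁻¹ x)) 0 x
    obtain ⟨b, hb⟩ := exists_le_iterate_of_forall_lt (f := e)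
      (continuous_iff_continuousAt.2 fun x => (he.1 x).continuousAt) hlt 0 x
    obtain ⟨n, hn, hn'⟩ := Int.exists_greatest_of_bdd (P := fun n : ℤ => s n ≤ x)
      ⟨b, fun z hz => hs_mono.le_iff_le.1 (hz.trans (by
        simpa [hs, Equiv.Perm.iterate_eq_pow] using hb))⟩
      ⟨-a, by
        simpa only [hs, zpow_neg, zpow_natCast, ← inv_pow, Equiv.Perm.iterate_eq_pow] using ha⟩
    refine ⟨n, hn, ?_⟩
    by_contra! hc
    linarith [hn' _ hc]
  choose N hN hN' using hex
  have hN_unique {x : ℝ} {n : ℤ} (h1 : s n ≤ x) (h2 : x < s (n + 1)) : N x = n := by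
    have h3 := hs_mono.lt_iff_lt.1 ((hN x).trans_lt h2)
    have h4 := hs_mono.lt_iff_lt.1 (h1.trans_lt (hN' x))
    omega
  have hzmono (n : ℤ) : StrictMono (e ^ n : Equiv.Perm ℝ) := (zpow_mem he n).2.2
  have hza (n : ℤ) (x : ℝ) : AnalyticAt ℝ (e ^ n : Equiv.Perm ℝ) x := (zpow_mem he n).1 x
  have hcancel (n : ℤ) (x : ℝ) : (e ^ n) ((e ^ (-n)) x) = x := by
    rw [← Equiv.Perm.mul_apply, ← zpow_add, add_neg_cancel, zpow_zero, Equiv.Perm.one_apply]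
  have hle_iff (n : ℤ) (y x : ℝ) : (e ^ n) y ≤ x ↔ y ≤ (e ^ (-n)) x := by
    rw [← (hzmono n).le_iff_le (b := (e ^ (-n)) x), hcancel]
  have hshift (n : ℤ) (x : ℝ) : (e ^ (-n)) x = e ((e ^ (-(n + 1))) x) := by
    rw [← Equiv.Perm.mul_apply, ← zpow_one_add]
    congr 2
    ring
  set H : ℝ → ℝ := fun x => h ((e ^ (-N x)) x) + N x with hH
  have hlocal (x : ℝ) : H =ᶠ[𝓝 x] fun z => h ((e ^ (-N x)) z) + N x := by
    obtain ⟨n, hn⟩ : ∃ n, N x = n := ⟨_, rfl⟩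
    have hx := hN x
    have hx' := hN' x
    rw [hn] at hx hx' ⊢
    have hc := (hza (-n) x).continuousAt
    have hlt' : ∀ᶠ z in 𝓝 x, z < s (n + 1) := eventually_lt_nhds hx'
    rcases hx.lt_or_eq with h1 | h1
    · filter_upwards [hlt', eventually_gt_nhds h1] with z h2 h3
      simp only [hH, hN_unique h3.le h2]
    · have h2 : (e ^ (-n)) x = 0 := by
        apply (e ^ n).injective
        rw [hcancel]
        exact h1.symm
      rw [ContinuousAt, h2] at hc
      have h3 : s (n - 1) < x := (hs_mono (sub_one_lt n)).trans_le hx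
      filter_upwards [hlt', eventually_gt_nhds h3, hc.eventually hab] with z h4 h5 h6
      rcases le_or_gt (s n) z with h7 | h7
      · simp only [hH, hN_unique h7 h4]
      · have h8 : N z = n - 1 := hN_unique h5.le (by rwa [sub_add_cancel])
        simp only [hH, h8]
        rw [hshift (n - 1), sub_add_cancel, h6]
        push_cast
        ring
  refine ⟨H, fun x => ?_, fun x => ?_⟩
  · have hmem : (e ^ (-N x)) x ∈ Icc 0 (e 0) := by
      refine ⟨(hle_iff _ _ _).1 (hN x), ?_⟩
      by_contra! hc
      have h1 := (hzmono (N x)) hc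
      rw [hcancel, ← Equiv.Perm.mul_apply, ← zpow_add_one] at h1
      exact lt_asymm h1 (hN' x)
    obtain ⟨h1, h2⟩ := hh _ hmem
    refine ⟨((h1.comp (hza _ x)).add analyticAt_const).congr (hlocal x).symm, ?_⟩
    rw [(hlocal x).deriv_eq]
    have h3 := (h1.differentiableAt.hasDerivAt.comp x
      (hza (-N x) x).differentiableAt.hasDerivAt).add_const (N x : ℝ)
    refine lt_of_lt_of_eq ?_ h3.deriv.symm
    refine mul_pos h2 ((hzmono _).deriv_pos_of_leftInverse
      (fun y => (hza _ y).differentiableAt) (fun y => (hza (N x) y).differentiableAt)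
      (hcancel _) x)
  · have h1 : N (e x) = N x + 1 := hN_unique
      (by rw [hs_succ]; exact he.2.2.monotone (hN x)) (by rw [hs_succ]; exact he.2.2 (hN' x))
    have h2 : (e ^ (-(N x + 1))) (e x) = (e ^ (-N x)) x := by
      rw [← Equiv.Perm.mul_apply, ← zpow_add_one]
      congr 2
      ring
    simp only [hH, h1, h2]
    push_cast
    ring

theorem exists_analytic_linearization {e : Equiv.Perm ℝ} (he : e ∈ analyticMonoPerm)
    (hlt : ∀ x, x < e x) :
    ∃ h g : ℝ → ℝ, (∀ x, AnalyticAt ℝ h x) ∧ (∀ x, AnalyticAt ℝ g x) ∧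
      Function.LeftInverse g h ∧ Function.RightInverse g h ∧ ∀ x, h (e x) = h x + 1 := by
  obtain ⟨H, hH, hHe⟩ := exists_analytic_abel_solution he hlt
  have hmono : StrictMono H := strictMono_of_deriv_pos fun x => (hH x).2
  have hiter (n : ℤ) : H ((e ^ n) 0) = H 0 + n := by
    induction n with
    | zero => simp
    | succ n ih =>
      rw [add_comm, zpow_one_add, Equiv.Perm.mul_apply, hHe, ih]
      push_cast
      ring
    | pred n ih =>
      have h1 := hHe ((e ^ (-(n : ℤ) - 1)) 0)
      rw [← Equiv.Perm.mul_apply, ← zpow_one_add, add_sub_cancel, ih] at h1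
      push_cast at h1 ⊢
      linarith
  have hsurj : Function.Surjective H := by
    refine Continuous.surjective (continuous_iff_continuousAt.2 fun x => (hH x).1.continuousAt)
      (tendsto_atTop_atTop_of_monotone hmono.monotone fun b => ?_)
      (tendsto_atBot_atBot_of_monotone hmono.monotone fun b => ?_)
    · refine ⟨(e ^ ⌈b - H 0⌉) 0, ?_⟩
      rw [hiter]
      linarith [Int.le_ceil (b - H 0)]
    · refine ⟨(e ^ ⌊b - H 0⌋) 0, ?_⟩
      rw [hiter]
      linarith [Int.floor_le (b - H 0)]
  let E : ℝ ≃ₜ ℝ := (hmono.orderIsoOfSurjective H hsurj).toHomeomorph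
  refine ⟨H, E.symm, fun x => (hH x).1, fun x => ?_, E.symm_apply_apply, E.apply_symm_apply, hHe⟩
  exact ((E.contDiff_symm_deriv (fun x => (hH x).2.ne')
    (fun x => (hH x).1.differentiableAt.hasDerivAt)
    (contDiff_iff_contDiffAt.2 fun x => (hH x).1.contDiffAt)).contDiffAt (x := x)).analyticAt

theorem mem_analyticMonoPerm_of_forall_lt {e : Equiv.Perm ℝ} (he : ∀ x, AnalyticAt ℝ e x)
    (he' : ∀ x, AnalyticAt ℝ (e⁻¹ : Equiv.Perm ℝ) x) (hlt : ∀ x, x < e x) :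
    e ∈ analyticMonoPerm := by
  refine ⟨he, he', ?_⟩
  refine ((continuous_iff_continuousAt.2 fun x =>
    (he x).continuousAt).strictMono_of_inj e.injective).resolve_right fun hanti => ?_
  exact lt_asymm (hanti (hlt 0)) (hlt (e 0))

end

/-- Belitskii–Lyubich: any real analytic diffeomorphism `φ : ℝ → ℝ` without
fixed points is real-analytically conjugate to the translation `x ↦ x + 1` or
`x ↦ x − 1`: there is a real analytic diffeomorphism `h` of `ℝ` with
`h (φ x) = h x ± 1` for all `x`. -/
theorem stmt_11 (φ ψ : ℝ → ℝ) (hφ : ∀ x, AnalyticAt ℝ φ x) (hψ : ∀ x, AnalyticAt ℝ ψ x)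
    (hinv₁ : Function.LeftInverse ψ φ) (hinv₂ : Function.RightInverse ψ φ)
    (hfix : ∀ x : ℝ, φ x ≠ x) :
    ∃ (h g : ℝ → ℝ) (ε : ℝ),
      (∀ x, AnalyticAt ℝ h x) ∧ (∀ x, AnalyticAt ℝ g x) ∧
      Function.LeftInverse g h ∧ Function.RightInverse g h ∧
      (ε = 1 ∨ ε = -1) ∧ ∀ x : ℝ, h (φ x) = h x + ε := by
  let e : Equiv.Perm ℝ := ⟨φ, ψ, hinv₁, hinv₂⟩
  have hcont : Continuous φ := continuous_iff_continuousAt.2 fun x => (hφ x).continuousAt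
  have hdich : (∀ x, x < φ x) ∨ ∀ x, φ x < x := by
    by_contra! hc
    obtain ⟨⟨x, hx⟩, y, hy⟩ := hc
    obtain ⟨z, hz⟩ := mem_range_of_exists_le_of_exists_ge (f := fun x => φ x - x)
      (hcont.sub continuous_id) (c := 0) ⟨x, sub_nonpos.2 hx⟩ ⟨y, sub_nonneg.2 hy⟩
    exact hfix z (sub_eq_zero.1 hz)
  rcases hdich with hlt | hgt
  · obtain ⟨h, g, hh, hg, hgh, hhg, hhe⟩ := exists_analytic_linearization
      (mem_analyticMonoPerm_of_forall_lt (e := e) hφ hψ hlt) hlt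
    exact ⟨h, g, 1, hh, hg, hgh, hhg, Or.inl rfl, hhe⟩
  · have hlt : ∀ x, x < (e⁻¹ : Equiv.Perm ℝ) x := fun x => by
      have h1 := hgt (ψ x)
      rw [hinv₂ x] at h1
      exact h1
    obtain ⟨h, g, hh, hg, hgh, hhg, hhe⟩ := exists_analytic_linearization
      (mem_analyticMonoPerm_of_forall_lt (e := e⁻¹) hψ hφ hlt) hlt
    refine ⟨h, g, -1, hh, hg, hgh, hhg, Or.inr rfl, fun x => ?_⟩
    have h1 : h (ψ (φ x)) = h (φ x) + 1 := hhe (φ x)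
    rw [hinv₁ x] at h1
    linarith
end
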